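/- Let λ₁ be the first Dirichlet eigenvalue of the Laplacian on B, i.e. λ₁ = inf{ ∫_B |∇u(x)|² dx / ∫_B u(x)² dx : u ∈ C_c^∞(B), u not identically zero }. Then for every λ with 0 ≤ λ < λ₁, the supremum of ∫_B e^{4π u(x)²} dx over all u ∈ C_c^∞(B) with ∫_B |∇u(x)|² dx − λ ∫_B u(x)² dx ≤ 1 is finite. -/

import Mathlib

open MeasureTheory Real Set Filter
open scoped ENNReal

noncomputable section

abbrev E2 := EuclideanSpace ℝ (Fin 2)

/-- The open unit disk in ℝ². -/
def unitDisk : Set E2 := Metric.ball 0 1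

/-- `u ∈ C_c^∞(Ω)`: smooth with compact support contained in `Ω`. -/
def IsTestFun (Ω : Set E2) (u : E2 → ℝ) : Prop :=
  ContDiff ℝ (⊤ : ℕ∞) u ∧ IsCompact (tsupport u) ∧ tsupport u ⊆ Ω

/-- The quadratic form `Q_V(u) = ∫_B |∇u|² - ∫_B V(|x|) u²`. -/
def QV (V : ℝ → ℝ) (u : E2 → ℝ) : ℝ :=
  (∫ x in unitDisk, ‖fderiv ℝ u x‖ ^ 2) - ∫ x in unitDisk, V ‖x‖ * u x ^ 2

/-- Weak coercivity of `Q_V`. -/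
def WeaklyCoercive (V : ℝ → ℝ) : Prop :=
  ∃ E : Set E2, IsOpen E ∧ IsCompact (closure E) ∧ closure E ⊆ unitDisk ∧
    ∃ δ : ℝ, 0 < δ ∧ ∀ u : E2 → ℝ, IsTestFun unitDisk u →
      δ * (∫ x in E, u x) ^ 2 ≤ QV V u

/-- The class 𝒱 of radial potentials. -/
def MemClassV (V : ℝ → ℝ) : Prop :=
  ContinuousOn V (Ioo 0 1) ∧ (∀ r ∈ Ioo (0:ℝ) 1, 0 ≤ V r) ∧
    AntitoneOn (fun r => (1 - r ^ 2) ^ 2 * V r) (Ioo 0 1)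

/-- Condition (K): `r² (log(1/r))^{2+α} V(r) → 0` as `r → 0⁺`, for some `α > 0`. -/
def CondK (V : ℝ → ℝ) : Prop :=
  ∃ α : ℝ, 0 < α ∧
    Tendsto (fun r : ℝ => r ^ 2 * Real.log (1 / r) ^ (2 + α) * V r)
      (nhdsWithin 0 (Ioi 0)) (nhds 0)

/-- The first Dirichlet eigenvalue of the Laplacian on `B` (Rayleigh quotient infimum). -/
def lambda1 : ℝ :=
  sInf {c : ℝ | ∃ u : E2 → ℝ, IsTestFun unitDisk u ∧ ¬ (∀ x : E2, u x = 0) ∧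
    c = (∫ x in unitDisk, ‖fderiv ℝ u x‖ ^ 2) / ∫ x in unitDisk, u x ^ 2}

theorem lintegral_polar (g : E2 → ℝ≥0∞) (hg : Measurable g) :
    ∫⁻ z, g z = ∫⁻ ω, (∫⁻ r in Ioi (0 : ℝ), ENNReal.ofReal r * g (r • (ω : E2)))
      ∂(volume : Measure E2).toSphere := by
  have h0 : ∫⁻ z, g z = ∫⁻ z in ({0}ᶜ : Set E2), g z := by rw [restrict_compl_singleton]
  have hm := (volume : Measure E2).measurePreserving_homeomorphUnitSphereProd
  have hg' : Measurable fun p : Metric.sphere (0 : E2) 1 × Ioi (0 : ℝ) =>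
      g ((p.2 : ℝ) • (p.1 : E2)) := by fun_prop
  have hdim : Module.finrank ℝ E2 - 1 = 1 := by simp
  rw [h0, ← lintegral_subtype_comap (measurableSet_singleton _).compl]
  have h1 : ∫⁻ z : ({0}ᶜ : Set E2), g z ∂((volume : Measure E2).comap (Subtype.val : ({0}ᶜ : Set E2) → E2)) =
      ∫⁻ p, g ((p.2 : ℝ) • (p.1 : E2))
        ∂((volume : Measure E2).toSphere.prod (.volumeIoiPow (Module.finrank ℝ E2 - 1))) := by
    rw [← hm.lintegral_comp hg']
    refine lintegral_congr fun z => ?_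
    congr 1
    have hz : ‖(z : E2)‖ ≠ 0 := norm_ne_zero_iff.2 z.2
    simp [smul_smul, mul_inv_cancel₀ hz]
  rw [h1, lintegral_prod _ hg'.aemeasurable]
  refine lintegral_congr fun ω => ?_
  rw [hdim, Measure.volumeIoiPow, lintegral_withDensity_eq_lintegral_mul _ (by fun_prop) (by fun_prop),
    ← lintegral_subtype_comap measurableSet_Ioi]
  simp

theorem toSphere_univ_E2 : (volume : Measure E2).toSphere univ = ENNReal.ofReal (2 * π) := by
  rw [Measure.toSphere_apply_univ, EuclideanSpace.volume_ball_fin_two]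
  simp [ENNReal.ofReal_mul]

theorem lintegral_radial (g : ℝ → ℝ≥0∞) (hg : Measurable g) :
    ∫⁻ z : E2, g ‖z‖ = ENNReal.ofReal (2 * π) * ∫⁻ r in Ioi (0 : ℝ), ENNReal.ofReal r * g r := by
  rw [lintegral_polar _ (by fun_prop), ← toSphere_univ_E2, mul_comm, ← lintegral_const]
  refine lintegral_congr fun ω => setLIntegral_congr_fun measurableSet_Ioi fun r hr => ?_
  have : ‖(ω : E2)‖ = 1 := by simp
  simp [norm_smul, this, abs_of_pos (mem_Ioi.1 hr)]

theorem enorm_le_lintegral_ray {v : E2 → ℝ} (hv : ContDiff ℝ 1 v) (hc : HasCompactSupport v)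
    (x : E2) {ω : E2} (hω : ‖ω‖ = 1) :
    ‖v x‖ₑ ≤ ∫⁻ r in Ioi (0 : ℝ), ‖fderiv ℝ v (x + r • ω)‖ₑ := by
  set γ : ℝ → E2 := fun r => x + r • ω
  have hγ : ∀ r, HasDerivAt γ ω r := fun r => by
    have h := ((hasDerivAt_id r).smul_const ω).const_add x
    rw [one_smul] at h
    exact h
  have hγi : Isometry γ := by
    refine Isometry.of_dist_eq fun a b => ?_
    simp [γ, dist_eq_norm, ← sub_smul, norm_smul, hω]
  have hcc : HasCompactSupport (v ∘ γ) := hc.comp_isClosedEmbedding hγi.isClosedEmbedding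
  have hcd : ContDiff ℝ 1 (v ∘ γ) := hv.comp (by fun_prop)
  have hd : ∀ r, deriv (v ∘ γ) r = fderiv ℝ v (γ r) ω := fun r =>
    (((hv.differentiable (by simp)) (γ r)).hasFDerivAt.comp_hasDerivAt r (hγ r)).deriv
  have hI := hcc.integral_Ioi_deriv_eq hcd 0
  have hx : ‖v x‖ₑ = ‖∫ r in Ioi (0 : ℝ), deriv (v ∘ γ) r‖ₑ := by
    rw [hI]; simp [γ]
  rw [hx]
  refine (enorm_integral_le_lintegral_enorm _).trans (lintegral_mono fun r => ?_)
  rw [hd]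
  have := (fderiv ℝ v (γ r)).le_opENorm ω
  rwa [show ‖ω‖ₑ = 1 by rw [← ofReal_norm, hω]; simp, mul_one] at this

theorem enorm_le_riesz {v : E2 → ℝ} (hv : ContDiff ℝ 1 v) (hc : HasCompactSupport v) (x : E2) :
    ENNReal.ofReal (2 * π) * ‖v x‖ₑ ≤ ∫⁻ y, ‖fderiv ℝ v y‖ₑ * ‖x - y‖ₑ⁻¹ := by
  have hm : Measurable fun y => ‖fderiv ℝ v y‖ₑ :=
    (hv.continuous_fderiv (by simp)).enorm.measurable
  have h1 : ∫⁻ y, ‖fderiv ℝ v y‖ₑ * ‖x - y‖ₑ⁻¹ = ∫⁻ z, ‖fderiv ℝ v (x + z)‖ₑ * ‖z‖ₑ⁻¹ := by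
    rw [← lintegral_add_left_eq_self _ x]
    simp
  rw [h1, lintegral_polar _ (by fun_prop), ← toSphere_univ_E2, mul_comm, ← lintegral_const]
  refine lintegral_mono fun ω => ?_
  have hω : ‖(ω : E2)‖ = 1 := by simp
  refine (enorm_le_lintegral_ray hv hc x hω).trans_eq
    (setLIntegral_congr_fun measurableSet_Ioi fun r hr => ?_)
  have hr0 : 0 < r := hr
  have : ‖r • (ω : E2)‖ₑ = ENNReal.ofReal r := by
    rw [← ofReal_norm, norm_smul, hω, mul_one, Real.norm_of_nonneg hr0.le]
  rw [this, mul_comm, mul_assoc, ENNReal.inv_mul_cancel (by simpa using hr0) ENNReal.ofReal_ne_top,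
    mul_one]

/-- The Riesz kernel of order one in the plane, perturbed by the constant `c`. -/
def rieszKernel (c : ℝ) (x y : E2) : ℝ≥0∞ := ‖x - y‖ₑ⁻¹ + ENNReal.ofReal c

theorem rieszKernel_comm (c : ℝ) (x y : E2) : rieszKernel c x y = rieszKernel c y x := by
  rw [rieszKernel, rieszKernel, ← enorm_neg (x - y), neg_sub]

theorem measurable_rieszKernel (c : ℝ) :
    Measurable fun p : E2 × E2 => rieszKernel c p.1 p.2 := by
  unfold rieszKernel; fun_prop

theorem setLIntegral_radial_le {s : Set ℝ} (hs : MeasurableSet s) (x : E2) {t : Set E2}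
    (hts : ∀ y ∈ t, ‖x - y‖ ∈ s) {g : ℝ → ℝ≥0∞} (hg : Measurable g) :
    ∫⁻ y in t, g ‖x - y‖ ≤
      ENNReal.ofReal (2 * π) * ∫⁻ r in Ioi 0 ∩ s, ENNReal.ofReal r * g r := by
  have h1 : ∫⁻ r in Ioi 0 ∩ s, ENNReal.ofReal r * g r =
      ∫⁻ r in Ioi 0, ENNReal.ofReal r * s.indicator g r := by
    rw [inter_comm, ← Measure.restrict_restrict hs, ← lintegral_indicator hs]
    refine lintegral_congr fun r => ?_
    by_cases hr : r ∈ s <;> simp [hr]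
  have h2 : ∫⁻ y, s.indicator g ‖x - y‖ = ∫⁻ z : E2, s.indicator g ‖z‖ :=
    lintegral_sub_left_eq_self (fun z : E2 => s.indicator g ‖z‖) x
  rw [h1, ← lintegral_radial _ (hg.indicator hs), ← h2]
  calc ∫⁻ y in t, g ‖x - y‖ ≤ ∫⁻ y in t, s.indicator g ‖x - y‖ := by
        refine setLIntegral_mono (by have := hg.indicator hs; fun_prop) fun y hy => ?_
        rw [indicator_of_mem (hts y hy)]
    _ ≤ _ := setLIntegral_le_lintegral _ _

theorem setLIntegral_ball_rieszKernel_le {c : ℝ} (hc : 0 ≤ c) (x : E2) {ρ : ℝ}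
    (hρ1 : ρ ≤ 1) :
    ∫⁻ y in Metric.ball x ρ, rieszKernel c x y ≤ ENNReal.ofReal (2 * π * (1 + c) * ρ) := by
  have h := setLIntegral_radial_le (s := Iio ρ) measurableSet_Iio x (t := Metric.ball x ρ)
    (fun y hy => by simpa [dist_eq_norm, norm_sub_rev] using hy)
    (g := fun r => (ENNReal.ofReal r)⁻¹ + ENNReal.ofReal c) (by fun_prop)
  have h2 : ∫⁻ r in Ioi 0 ∩ Iio ρ, ENNReal.ofReal r * ((ENNReal.ofReal r)⁻¹ + ENNReal.ofReal c) ≤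
      ENNReal.ofReal (1 + c) * ENNReal.ofReal ρ := by
    calc _ ≤ ∫⁻ r in Ioi 0 ∩ Iio ρ, ENNReal.ofReal (1 + c) := by
          refine setLIntegral_mono measurable_const fun r hr => ?_
          have hr0 : 0 < r := hr.1
          have hr1 : r ≤ 1 := (le_of_lt hr.2).trans hρ1
          rw [← ENNReal.ofReal_inv_of_pos hr0, ← ENNReal.ofReal_add (by positivity) hc,
            ← ENNReal.ofReal_mul hr0.le]
          refine ENNReal.ofReal_le_ofReal ?_
          rw [mul_add, mul_inv_cancel₀ hr0.ne']
          nlinarith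
      _ = _ := by
          rw [setLIntegral_const, Ioi_inter_Iio, Real.volume_Ioo, sub_zero]
  calc ∫⁻ y in Metric.ball x ρ, rieszKernel c x y
      = ∫⁻ y in Metric.ball x ρ, ((ENNReal.ofReal ‖x - y‖)⁻¹ + ENNReal.ofReal c) := by
        simp [rieszKernel, ofReal_norm]
    _ ≤ _ := h
    _ ≤ ENNReal.ofReal (2 * π) * (ENNReal.ofReal (1 + c) * ENNReal.ofReal ρ) := by gcongr
    _ = _ := by
      rw [← ENNReal.ofReal_mul (by positivity), ← ENNReal.ofReal_mul (by positivity)]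
      ring_nf

theorem rieszKernel_le {c : ℝ} (hc : 0 ≤ c) {x y : E2} {ρ : ℝ} (hρ : 0 < ρ)
    (h : ρ ≤ ‖x - y‖) : rieszKernel c x y ≤ ENNReal.ofReal (ρ⁻¹ + c) := by
  rw [rieszKernel, ENNReal.ofReal_add (by positivity) hc, ENNReal.ofReal_inv_of_pos hρ,
    ← ofReal_norm]
  gcongr

theorem setLIntegral_sq_rieszKernel_le {c : ℝ} (hc : 0 ≤ c) {x : E2} (hx : x ∈ unitDisk) {ρ : ℝ}
    (hρ : 0 < ρ) (hρ1 : ρ ≤ 1) :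
    ∫⁻ y in unitDisk \ Metric.ball x ρ, rieszKernel c x y ^ 2 ≤
      ENNReal.ofReal (2 * π * log (1 / ρ) + 2 * π * (1 + 4 * (c + c ^ 2))) := by
  have hx1 : ‖x‖ < 1 := by simpa [unitDisk] using hx
  have h := setLIntegral_radial_le (s := Icc ρ 2) measurableSet_Icc x
    (t := unitDisk \ Metric.ball x ρ)
    (fun y hy => by
      have hy1 : ‖y‖ < 1 := by simpa [unitDisk] using hy.1
      have hy2 : ρ ≤ ‖x - y‖ := by simpa [dist_eq_norm, norm_sub_rev] using hy.2
      exact ⟨hy2, (norm_sub_le _ _).trans (by linarith)⟩)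
    (g := fun r => ((ENNReal.ofReal r)⁻¹ + ENNReal.ofReal c) ^ 2) (by fun_prop)
  have hI : ∫ r in ρ..2, (r⁻¹ + (2 * c + 2 * c ^ 2)) =
      log (2 / ρ) + (2 - ρ) * (2 * c + 2 * c ^ 2) := by
    rw [intervalIntegral.integral_add, integral_inv_of_pos hρ two_pos,
      intervalIntegral.integral_const, smul_eq_mul]
    · refine intervalIntegrable_inv_iff.2 (Or.inr ?_)
      rw [uIcc_of_le (by linarith)]
      exact fun h0 => absurd h0.1 (not_le.2 hρ)
    · exact intervalIntegrable_const
  have hInt : IntegrableOn (fun r : ℝ => r⁻¹ + (2 * c + 2 * c ^ 2)) (Icc ρ 2) := by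
    refine ContinuousOn.integrableOn_Icc ?_
    refine ContinuousOn.add (continuousOn_id.inv₀ fun r hr => ?_) continuousOn_const
    exact (hρ.trans_le hr.1).ne'
  have hlog : log (2 / ρ) ≤ log (1 / ρ) + 1 := by
    rw [log_div two_ne_zero hρ.ne', log_div one_ne_zero hρ.ne', log_one]
    have := Real.log_two_lt_d9
    linarith
  have hlog0 : 0 ≤ log (1 / ρ) := Real.log_nonneg (by rw [le_div_iff₀ hρ]; linarith)
  have h2 : ∫⁻ r in Ioi 0 ∩ Icc ρ 2,
      ENNReal.ofReal r * ((ENNReal.ofReal r)⁻¹ + ENNReal.ofReal c) ^ 2 ≤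
      ENNReal.ofReal (log (1 / ρ) + (1 + 4 * (c + c ^ 2))) := by
    calc _ ≤ ∫⁻ r in Icc ρ 2, ENNReal.ofReal (r⁻¹ + (2 * c + 2 * c ^ 2)) := by
          refine (lintegral_mono_set inter_subset_right).trans
            (setLIntegral_mono (by fun_prop) fun r hr => ?_)
          have hr0 : 0 < r := hρ.trans_le hr.1
          rw [← ENNReal.ofReal_inv_of_pos hr0, ← ENNReal.ofReal_add (by positivity) hc,
            ← ENNReal.ofReal_pow (by positivity), ← ENNReal.ofReal_mul hr0.le]
          refine ENNReal.ofReal_le_ofReal ?_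
          have : r * (r⁻¹ + c) ^ 2 = r⁻¹ + (2 * c + r * c ^ 2) := by field_simp; ring
          rw [this]
          nlinarith [hr.2, sq_nonneg c]
      _ = ENNReal.ofReal (log (2 / ρ) + (2 - ρ) * (2 * c + 2 * c ^ 2)) := by
          rw [← ofReal_integral_eq_lintegral_ofReal hInt, integral_Icc_eq_integral_Ioc,
            ← intervalIntegral.integral_of_le (by linarith), hI]
          filter_upwards [ae_restrict_mem measurableSet_Icc] with r hr
          have hr0 : 0 < r := hρ.trans_le hr.1
          simp only [Pi.zero_apply]
          positivity
      _ ≤ _ := by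
          refine ENNReal.ofReal_le_ofReal ?_
          nlinarith [sq_nonneg c, mul_nonneg hρ.le hc, mul_nonneg hρ.le (sq_nonneg c)]
  calc _ = ∫⁻ y in unitDisk \ Metric.ball x ρ,
        ((ENNReal.ofReal ‖x - y‖)⁻¹ + ENNReal.ofReal c) ^ 2 := by
        simp [rieszKernel, ofReal_norm]
    _ ≤ _ := h
    _ ≤ ENNReal.ofReal (2 * π) * ENNReal.ofReal (log (1 / ρ) + (1 + 4 * (c + c ^ 2))) := by gcongr
    _ = _ := by
      rw [← ENNReal.ofReal_mul (by positivity)]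
      ring_nf

/-- The mean over `E` of the kernel. -/
def avgKernel (c : ℝ) (E : Set E2) (y : E2) : ℝ≥0∞ :=
  (volume E)⁻¹ * ∫⁻ x in E, rieszKernel c x y

theorem measurable_avgKernel (c : ℝ) (E : Set E2) : Measurable (avgKernel c E) := by
  have := measurable_rieszKernel c
  exact (Measurable.lintegral_prod_left' (μ := volume.restrict E) this).const_mul _

theorem avgKernel_le {c : ℝ} (hc : 0 ≤ c) {E : Set E2} (hEf : volume E ≠ ∞)
    {ρ : ℝ} (hρ : 0 < ρ) (hρ1 : ρ ≤ 1) (hEρ : ENNReal.ofReal (π * ρ ^ 2) ≤ volume E) (y : E2) :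
    avgKernel c E y ≤ ENNReal.ofReal (3 * (1 + c) * ρ⁻¹) := by
  have hE0 : volume E ≠ 0 := fun h => by
    rw [h] at hEρ
    have : 0 < ENNReal.ofReal (π * ρ ^ 2) := ENNReal.ofReal_pos.2 (by positivity)
    exact absurd hEρ (not_le.2 this)
  have h1 : ∫⁻ x in E, rieszKernel c x y ≤
      ENNReal.ofReal (2 * π * (1 + c) * ρ) + ENNReal.ofReal (ρ⁻¹ + c) * volume E := by
    rw [← lintegral_inter_add_sdiff _ E (measurableSet_ball (x := y) (ε := ρ))]
    refine add_le_add ?_ ?_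
    · refine (lintegral_mono_set inter_subset_right).trans ?_
      simp_rw [fun x => rieszKernel_comm c x y]
      exact setLIntegral_ball_rieszKernel_le hc y hρ1
    · calc _ ≤ ∫⁻ x in E \ Metric.ball y ρ, ENNReal.ofReal (ρ⁻¹ + c) := by
            refine setLIntegral_mono measurable_const fun x hx => rieszKernel_le hc hρ ?_
            simpa [dist_eq_norm] using hx.2
        _ ≤ _ := by
            rw [setLIntegral_const]
            gcongr
            exact sdiff_subset
  calc avgKernel c E y ≤ (volume E)⁻¹ * (ENNReal.ofReal (2 * π * (1 + c) * ρ) +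
        ENNReal.ofReal (ρ⁻¹ + c) * volume E) := by unfold avgKernel; gcongr
    _ = (volume E)⁻¹ * ENNReal.ofReal (2 * π * (1 + c) * ρ) + ENNReal.ofReal (ρ⁻¹ + c) := by
        rw [mul_add, mul_comm (ENNReal.ofReal (ρ⁻¹ + c)), ← mul_assoc,
          ENNReal.inv_mul_cancel hE0 hEf, one_mul]
    _ ≤ (ENNReal.ofReal (π * ρ ^ 2))⁻¹ * ENNReal.ofReal (2 * π * (1 + c) * ρ) +
        ENNReal.ofReal (ρ⁻¹ + c) := by gcongr
    _ ≤ _ := by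
        rw [← ENNReal.ofReal_inv_of_pos (by positivity), ← ENNReal.ofReal_mul (by positivity),
          ← ENNReal.ofReal_add (by positivity) (by positivity)]
        refine ENNReal.ofReal_le_ofReal ?_
        have hρi : 1 ≤ ρ⁻¹ := (one_le_inv₀ hρ).2 hρ1
        have : (π * ρ ^ 2)⁻¹ * (2 * π * (1 + c) * ρ) = 2 * (1 + c) * ρ⁻¹ := by
          field_simp
        rw [this]
        nlinarith

theorem ENNReal.two_mul_mul_le_add_sq (a b : ℝ≥0∞) : 2 * (a * b) ≤ a ^ 2 + b ^ 2 := by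
  induction a with
  | top => simp
  | coe a =>
    induction b with
    | top => simp
    | coe b =>
      have := two_mul_le_add_sq a b
      rw [mul_assoc] at this
      exact_mod_cast this

/-- Additive constant in the energy bound for the averaged kernel. -/
def gramConst (c : ℝ) : ℝ := 12 * π * (1 + c) ^ 2 + 2 * π * (1 + 4 * (c + c ^ 2))

theorem volume_unitDisk : volume unitDisk = ENNReal.ofReal π := by
  simp [unitDisk, EuclideanSpace.volume_ball_fin_two]

theorem log_one_div_nonneg {ρ : ℝ} (hρ : 0 < ρ) (hρ1 : ρ ≤ 1) : 0 ≤ log (1 / ρ) :=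
  Real.log_nonneg (by rw [le_div_iff₀ hρ]; linarith)

/-- The product of the mean with a constant is bounded by that constant. -/
theorem inv_volume_mul_setLIntegral_le {E : Set E2} (hEm : MeasurableSet E) {g : E2 → ℝ≥0∞}
    {b : ℝ≥0∞} (hg : ∀ x ∈ E, g x ≤ b) : (volume E)⁻¹ * ∫⁻ x in E, g x ≤ b := by
  calc (volume E)⁻¹ * ∫⁻ x in E, g x ≤ (volume E)⁻¹ * (b * volume E) := by
        gcongr
        rw [← setLIntegral_const]
        exact setLIntegral_mono' hEm hg
    _ = b * ((volume E)⁻¹ * volume E) := by ring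
    _ ≤ b * 1 := by gcongr; exact ENNReal.inv_mul_le_one _
    _ = b := mul_one _

theorem lintegral_mul_avgKernel {c : ℝ} {E : Set E2} {g : E2 → ℝ≥0∞} (hg : Measurable g) :
    ∫⁻ y in unitDisk, g y * avgKernel c E y =
      (volume E)⁻¹ * ∫⁻ x in E, ∫⁻ y in unitDisk, g y * rieszKernel c x y := by
  have hk := measurable_rieszKernel c
  have hg2 : Measurable (Function.uncurry fun x y : E2 => g y * rieszKernel c x y) :=
    (hg.comp measurable_snd).mul hk
  have hm : Measurable fun y => ∫⁻ x in E, g y * rieszKernel c x y :=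
    Measurable.lintegral_prod_left' hg2
  have e : ∀ y, g y * avgKernel c E y = (volume E)⁻¹ * ∫⁻ x in E, g y * rieszKernel c x y := by
    intro y
    have hky : Measurable fun x => rieszKernel c x y := by
      unfold rieszKernel; fun_prop
    rw [lintegral_const_mul _ hky, avgKernel, mul_left_comm]
  simp_rw [e]
  rw [lintegral_const_mul _ hm, lintegral_lintegral_swap hg2.aemeasurable]

theorem two_mul_potential_le {c : ℝ} (hc : 0 ≤ c) {E : Set E2} (hEB : E ⊆ unitDisk)
    {ρ : ℝ} (hρ : 0 < ρ) (hρ1 : ρ ≤ 1) (hEρ : ENNReal.ofReal (π * ρ ^ 2) ≤ volume E)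
    {x : E2} (hx : x ∈ unitDisk) :
    2 * ∫⁻ y in unitDisk, avgKernel c E y * rieszKernel c x y ≤
      ENNReal.ofReal (2 * π * log (1 / ρ) + gramConst c) +
        ∫⁻ y in unitDisk, avgKernel c E y ^ 2 := by
  have hEf : volume E ≠ ∞ := ((measure_mono hEB).trans_lt (by
    rw [volume_unitDisk]; exact ENNReal.ofReal_lt_top)).ne
  have hk : Measurable fun y => rieszKernel c x y := by
    unfold rieszKernel; fun_prop
  have hlog := log_one_div_nonneg hρ hρ1
  rw [← lintegral_inter_add_sdiff _ unitDisk (Metric.isOpen_ball (x := x) (ε := ρ)).measurableSet,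
    mul_add]
  have h1 : 2 * ∫⁻ y in unitDisk ∩ Metric.ball x ρ, avgKernel c E y * rieszKernel c x y ≤
      ENNReal.ofReal (12 * π * (1 + c) ^ 2) := by
    calc _ ≤ 2 * ∫⁻ y in Metric.ball x ρ,
          ENNReal.ofReal (3 * (1 + c) * ρ⁻¹) * rieszKernel c x y := by
          gcongr 2 * ?_
          refine (lintegral_mono_set inter_subset_right).trans (lintegral_mono fun y => ?_)
          gcongr
          exact avgKernel_le hc hEf hρ hρ1 hEρ y
      _ ≤ 2 * (ENNReal.ofReal (3 * (1 + c) * ρ⁻¹) * ENNReal.ofReal (2 * π * (1 + c) * ρ)) := by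
          rw [lintegral_const_mul _ hk]
          gcongr
          exact setLIntegral_ball_rieszKernel_le hc x hρ1
      _ = _ := by
          rw [← ENNReal.ofReal_mul (by positivity), ← ENNReal.ofReal_ofNat,
            ← ENNReal.ofReal_mul (by positivity)]
          congr 1
          field_simp
          ring
  have h2 : 2 * ∫⁻ y in unitDisk \ Metric.ball x ρ, avgKernel c E y * rieszKernel c x y ≤
      ENNReal.ofReal (2 * π * log (1 / ρ) + 2 * π * (1 + 4 * (c + c ^ 2))) +
        ∫⁻ y in unitDisk, avgKernel c E y ^ 2 := by
    have hm := measurable_avgKernel c E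
    have hmk : Measurable fun y => avgKernel c E y * rieszKernel c x y := hm.mul hk
    calc _ = ∫⁻ y in unitDisk \ Metric.ball x ρ, 2 * (avgKernel c E y * rieszKernel c x y) := by
          rw [lintegral_const_mul _ hmk]
      _ ≤ ∫⁻ y in unitDisk \ Metric.ball x ρ, (avgKernel c E y ^ 2 + rieszKernel c x y ^ 2) :=
          lintegral_mono fun y => ENNReal.two_mul_mul_le_add_sq _ _
      _ = (∫⁻ y in unitDisk \ Metric.ball x ρ, avgKernel c E y ^ 2) +
            ∫⁻ y in unitDisk \ Metric.ball x ρ, rieszKernel c x y ^ 2 :=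
          lintegral_add_left (hm.pow_const 2) _
      _ ≤ _ := by
          rw [add_comm]
          refine add_le_add (setLIntegral_sq_rieszKernel_le hc hx hρ hρ1) ?_
          exact lintegral_mono_set sdiff_subset
  refine (add_le_add h1 h2).trans_eq ?_
  rw [← add_assoc, ← ENNReal.ofReal_add (by positivity) (by positivity), gramConst]
  ring_nf

theorem setLIntegral_sq_avgKernel_le {c : ℝ} (hc : 0 ≤ c) {E : Set E2} (hEm : MeasurableSet E) (hEB : E ⊆ unitDisk)
    {ρ : ℝ} (hρ : 0 < ρ) (hρ1 : ρ ≤ 1) (hEρ : ENNReal.ofReal (π * ρ ^ 2) ≤ volume E) :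
    ∫⁻ y in unitDisk, avgKernel c E y ^ 2 ≤
      ENNReal.ofReal (2 * π * log (1 / ρ) + gramConst c) := by
  have hEf : volume E ≠ ∞ := ((measure_mono hEB).trans_lt (by
    rw [volume_unitDisk]; exact ENNReal.ofReal_lt_top)).ne
  have hm := measurable_avgKernel c E
  set M := ∫⁻ y in unitDisk, avgKernel c E y ^ 2 with hM
  have hMf : M ≠ ∞ := by
    refine ne_top_of_le_ne_top (b := ENNReal.ofReal (3 * (1 + c) * ρ⁻¹) ^ 2 * volume unitDisk)
      ?_ ?_
    · rw [volume_unitDisk]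
      exact ENNReal.mul_ne_top (ENNReal.pow_ne_top ENNReal.ofReal_ne_top) ENNReal.ofReal_ne_top
    · rw [← setLIntegral_const]
      refine lintegral_mono fun y => ?_
      gcongr
      exact avgKernel_le hc hEf hρ hρ1 hEρ y
  have h2M : 2 * M ≤ ENNReal.ofReal (2 * π * log (1 / ρ) + gramConst c) + M := by
    calc 2 * M = 2 * ((volume E)⁻¹ * ∫⁻ x in E, ∫⁻ y in unitDisk,
          avgKernel c E y * rieszKernel c x y) := by
          rw [← lintegral_mul_avgKernel hm, hM]
          simp_rw [sq]
      _ = (volume E)⁻¹ * ∫⁻ x in E, 2 * ∫⁻ y in unitDisk,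
          avgKernel c E y * rieszKernel c x y := by
          rw [lintegral_const_mul]
          · ring
          · exact Measurable.lintegral_prod_right' (f := fun p : E2 × E2 =>
              avgKernel c E p.2 * rieszKernel c p.1 p.2)
              ((hm.comp measurable_snd).mul (measurable_rieszKernel c))
      _ ≤ _ := inv_volume_mul_setLIntegral_le hEm fun x hx =>
          two_mul_potential_le hc hEB hρ hρ1 hEρ (hEB hx)
  rw [two_mul] at h2M
  exact (ENNReal.add_le_add_iff_right hMf).1 h2M

theorem setLIntegral_avgKernel_mul_le {c : ℝ} (hc : 0 ≤ c) {E : Set E2} (hEm : MeasurableSet E) (hEB : E ⊆ unitDisk)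
    {ρ : ℝ} (hρ : 0 < ρ) (hρ1 : ρ ≤ 1) (hEρ : ENNReal.ofReal (π * ρ ^ 2) ≤ volume E)
    {E' : Set E2} (hEm' : MeasurableSet E')
    (hEB' : E' ⊆ unitDisk) :
    ∫⁻ y in unitDisk, avgKernel c E y * avgKernel c E' y ≤
      ENNReal.ofReal (2 * π * log (1 / ρ) + gramConst c) := by
  rw [lintegral_mul_avgKernel (measurable_avgKernel c E)]
  refine inv_volume_mul_setLIntegral_le hEm' fun x hx => ?_
  have h := (two_mul_potential_le hc hEB hρ hρ1 hEρ (hEB' hx)).trans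
    (add_le_add_right (setLIntegral_sq_avgKernel_le hc hEm hEB hρ hρ1 hEρ) _)
  rw [← two_mul] at h
  exact (ENNReal.mul_le_mul_iff_right two_ne_zero ENNReal.ofNat_ne_top).1 h

theorem ENNReal.sq_lintegral_mul_le {α : Type*} [MeasurableSpace α] (μ : Measure α)
    {f g : α → ℝ≥0∞} (hf : AEMeasurable f μ) (hg : AEMeasurable g μ) :
    (∫⁻ x, f x * g x ∂μ) ^ 2 ≤ (∫⁻ x, f x ^ 2 ∂μ) * ∫⁻ x, g x ^ 2 ∂μ := by
  have h := ENNReal.lintegral_mul_le_Lp_mul_Lq μ Real.HolderConjugate.two_two hf hg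
  simp only [Pi.mul_apply, ENNReal.rpow_two] at h
  calc (∫⁻ x, f x * g x ∂μ) ^ 2
      ≤ ((∫⁻ x, f x ^ 2 ∂μ) ^ (1 / 2 : ℝ) * (∫⁻ x, g x ^ 2 ∂μ) ^ (1 / 2 : ℝ)) ^ 2 := by gcongr
    _ = _ := by
      rw [mul_pow, ← ENNReal.rpow_two, ← ENNReal.rpow_two, ← ENNReal.rpow_mul,
        ← ENNReal.rpow_mul]
      norm_num

/-- The two-level estimate behind the sharp exponential integrability. -/
theorem two_level_le {c : ℝ} (hc : 0 ≤ c) {u : E2 → ℝ} {f : E2 → ℝ≥0∞} (hf : Measurable f)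
    (hf1 : ∫⁻ y in unitDisk, f y ^ 2 ≤ 1)
    (hu : ∀ x ∈ unitDisk, ENNReal.ofReal (2 * π) * ‖u x‖ₑ ≤
      ∫⁻ y in unitDisk, f y * rieszKernel c x y)
    {E E' : Set E2} (hE : MeasurableSet E) (hE' : MeasurableSet E') (hEB : E ⊆ unitDisk)
    (hEB' : E' ⊆ unitDisk) {ρ ρ' : ℝ} (hρ : 0 < ρ) (hρ' : 0 < ρ') (hρ1 : ρ ≤ 1) (hρ1' : ρ' ≤ 1)
    (hEρ : ENNReal.ofReal (π * ρ ^ 2) ≤ volume E)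
    (hEρ' : ENNReal.ofReal (π * ρ' ^ 2) ≤ volume E')
    {s s' : ℝ} (hs : 0 ≤ s) (hs' : 0 ≤ s') (hsE : ∀ x ∈ E, s ≤ |u x|)
    (hsE' : ∀ x ∈ E', s' ≤ |u x|) :
    4 * π * (s + s') ^ 2 ≤ 3 * (2 * log (1 / ρ) + gramConst c / π) +
      (2 * log (1 / ρ') + gramConst c / π) := by
  have key : ∀ {E : Set E2} {ρ s : ℝ}, MeasurableSet E → E ⊆ unitDisk → 0 < ρ →
      ENNReal.ofReal (π * ρ ^ 2) ≤ volume E → (∀ x ∈ E, s ≤ |u x|) →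
      ENNReal.ofReal (2 * π * s) ≤ ∫⁻ y in unitDisk, f y * avgKernel c E y := by
    intro E ρ s hE hEB hρ hEρ hsE
    have hE0 : volume E ≠ 0 := fun h => by
      rw [h] at hEρ
      have : 0 < ENNReal.ofReal (π * ρ ^ 2) := ENNReal.ofReal_pos.2 (by positivity)
      exact absurd hEρ (not_le.2 this)
    have hEf : volume E ≠ ∞ := ((measure_mono hEB).trans_lt (by
      rw [volume_unitDisk]; exact ENNReal.ofReal_lt_top)).ne
    rw [lintegral_mul_avgKernel hf]
    calc ENNReal.ofReal (2 * π * s)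
        = (volume E)⁻¹ * ∫⁻ x in E, ENNReal.ofReal (2 * π * s) := by
          rw [setLIntegral_const, mul_comm (ENNReal.ofReal _), ← mul_assoc,
            ENNReal.inv_mul_cancel hE0 hEf, one_mul]
      _ ≤ _ := by
          refine mul_le_mul_right (setLIntegral_mono' hE fun x hx => ?_) _
          refine le_trans ?_ (hu x (hEB hx))
          rw [ENNReal.ofReal_mul (by positivity)]
          gcongr
          rw [← ofReal_norm, Real.norm_eq_abs]
          exact ENNReal.ofReal_le_ofReal (hsE x hx)
  wlog hρρ : ρ' ≤ ρ generalizing E E' ρ ρ' s s'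
  · have := this hE' hE hEB' hEB hρ' hρ hρ1' hρ1 hEρ' hEρ hs' hs hsE' hsE (le_of_not_ge hρρ)
    have hl : log (1 / ρ') ≤ log (1 / ρ) := by
      have := le_of_not_ge hρρ
      gcongr
    rw [add_comm s']  at this
    linarith
  have hl := log_one_div_nonneg hρ hρ1
  have hl' := log_one_div_nonneg hρ' hρ1'
  have hg0 : 0 ≤ gramConst c := by unfold gramConst; positivity
  have hm := measurable_avgKernel c E
  have hm' := measurable_avgKernel c E'
  have hfm : Measurable fun y => f y * avgKernel c E y := hf.mul hm
  have hmm : Measurable fun y => avgKernel c E y * avgKernel c E' y := hm.mul hm'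
  have h1 : ENNReal.ofReal (2 * π * (s + s')) ≤
      ∫⁻ y in unitDisk, f y * (avgKernel c E y + avgKernel c E' y) := by
    simp_rw [mul_add]
    rw [ENNReal.ofReal_add (by positivity) (by positivity), lintegral_add_left hfm]
    exact add_le_add (key hE hEB hρ hEρ hsE) (key hE' hEB' hρ' hEρ' hsE')
  have h2 : ∫⁻ y in unitDisk, (avgKernel c E y + avgKernel c E' y) ^ 2 ≤
      ENNReal.ofReal (3 * (2 * π * log (1 / ρ) + gramConst c) +
        (2 * π * log (1 / ρ') + gramConst c)) := by
    have e : ∀ y, (avgKernel c E y + avgKernel c E' y) ^ 2 = avgKernel c E y ^ 2 +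
        (2 * (avgKernel c E y * avgKernel c E' y) + avgKernel c E' y ^ 2) := fun y => by ring
    simp_rw [e]
    rw [lintegral_add_left (hm.pow_const 2), lintegral_add_left (hmm.const_mul 2),
      lintegral_const_mul 2 hmm, ENNReal.ofReal_add (by positivity) (by positivity),
      show (3 : ℝ) * (2 * π * log (1 / ρ) + gramConst c) = (2 * π * log (1 / ρ) + gramConst c) +
        2 * (2 * π * log (1 / ρ) + gramConst c) by ring,
      ENNReal.ofReal_add (by positivity) (by positivity), ENNReal.ofReal_mul (p := 2) (by norm_num),
      ENNReal.ofReal_ofNat, add_assoc]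
    gcongr
    · exact setLIntegral_sq_avgKernel_le hc hE hEB hρ hρ1 hEρ
    · exact setLIntegral_avgKernel_mul_le hc hE hEB hρ hρ1 hEρ hE' hEB'
    · exact setLIntegral_sq_avgKernel_le hc hE' hEB' hρ' hρ1' hEρ'
  have h3 : ENNReal.ofReal ((2 * π * (s + s')) ^ 2) ≤
      ENNReal.ofReal (3 * (2 * π * log (1 / ρ) + gramConst c) +
        (2 * π * log (1 / ρ') + gramConst c)) := by
    rw [ENNReal.ofReal_pow (by positivity)]
    calc _ ≤ (∫⁻ y in unitDisk, f y * (avgKernel c E y + avgKernel c E' y)) ^ 2 := by gcongr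
      _ ≤ _ := ENNReal.sq_lintegral_mul_le _ hf.aemeasurable (hm.add hm').aemeasurable
      _ ≤ 1 * _ := mul_le_mul' hf1 h2
      _ = _ := one_mul _
  have h4 := (ENNReal.ofReal_le_ofReal_iff (by positivity)).1 h3
  have e1 : 4 * π * (s + s') ^ 2 = (2 * π * (s + s')) ^ 2 / π := by field_simp; ring
  have e2 : 3 * (2 * log (1 / ρ) + gramConst c / π) + (2 * log (1 / ρ') + gramConst c / π) =
      (3 * (2 * π * log (1 / ρ) + gramConst c) + (2 * π * log (1 / ρ') + gramConst c)) / π := by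
    field_simp
  rw [e1, e2]
  gcongr

section

variable {K : ℝ} {W : ℕ → ℝ}

theorem gap_le (hK : 0 ≤ K) (hW : ∀ j, 0 ≤ W j)
    (h : ∀ i j, i ≤ j → (W i + W j) ^ 2 ≤ 3 * (i * log 2 + K) + (j * log 2 + K))
    {n i j : ℕ} (hij : i ≤ j) (hi : i * log 2 + K - W i ^ 2 ≤ n + 1)
    (hj : j * log 2 + K - W j ^ 2 ≤ n + 1) (hin : 3 * (n + 1) ≤ i) : j ≤ i + 12 * (n + 1) := by
  have hl := Real.log_two_gt_d9
  have hij' : (i : ℝ) ≤ j := by exact_mod_cast hij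
  have hin' : 3 * ((n : ℝ) + 1) ≤ i := by exact_mod_cast hin
  have hn : (0 : ℝ) ≤ n := n.cast_nonneg
  set l : ℝ := (n : ℝ) + 1 with hl_def
  have hl1 : 1 ≤ l := by linarith
  set X : ℝ := i * log 2 + K - l with hX
  set D : ℝ := (j - i : ℝ) * log 2 with hD
  have hD0 : 0 ≤ D := mul_nonneg (by linarith) (by linarith)
  have hXl : l ≤ X := by nlinarith
  have h1 : X ≤ W i ^ 2 := by linarith
  have h2 : X + D ≤ W j ^ 2 := by rw [hX, hD]; linarith
  have h3 : (W i + W j) ^ 2 ≤ 4 * X + 4 * l + D := by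
    have := h i j hij
    rw [hX, hD]; linarith
  have h4 : W i * W j ≤ X + 2 * l := by nlinarith
  have h5 : X * (X + D) ≤ (W i * W j) ^ 2 := by
    rw [mul_pow]; exact mul_le_mul h1 h2 (by linarith) (sq_nonneg _)
  have h6 : (W i * W j) ^ 2 ≤ (X + 2 * l) ^ 2 :=
    pow_le_pow_left₀ (mul_nonneg (hW i) (hW j)) h4 2
  have h7 : D ≤ 8 * l := by
    by_contra hc
    push Not at hc
    nlinarith
  have h8 : (j : ℝ) ≤ i + 12 * l := by
    by_contra hc
    push Not at hc
    have : 12 * l * log 2 ≤ D := by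
      rw [hD]; exact mul_le_mul_of_nonneg_right (by linarith) (by linarith)
    nlinarith
  rw [hl_def] at h8
  exact_mod_cast h8

theorem exists_finset_of_le (hK : 0 ≤ K) (hW : ∀ j, 0 ≤ W j)
    (h : ∀ i j, i ≤ j → (W i + W j) ^ 2 ≤ 3 * (i * log 2 + K) + (j * log 2 + K)) (n : ℕ) :
    ∃ s : Finset ℕ, s.card ≤ 16 * (n + 1) ∧
      ∀ j : ℕ, j * log 2 + K - W j ^ 2 ≤ n + 1 → j ∈ s := by
  classical
  by_cases hex : ∃ i : ℕ, 3 * (n + 1) ≤ i ∧ i * log 2 + K - W i ^ 2 ≤ n + 1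
  · set i := Nat.find hex with hi
    obtain ⟨hi1, hi2⟩ := Nat.find_spec hex
    refine ⟨Finset.range (3 * (n + 1)) ∪ Finset.Icc i (i + 12 * (n + 1)), ?_, fun j hj => ?_⟩
    · refine (Finset.card_union_le _ _).trans ?_
      simp only [Finset.card_range, Nat.card_Icc]
      omega
    · rw [Finset.mem_union, Finset.mem_range, Finset.mem_Icc]
      by_cases hj3 : j < 3 * (n + 1)
      · exact Or.inl hj3
      · have hij : i ≤ j := Nat.find_min' hex ⟨not_lt.1 hj3, hj⟩
        exact Or.inr ⟨hij, gap_le hK hW h hij hi2 hj hi1⟩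
  · refine ⟨Finset.range (3 * (n + 1)), by simp only [Finset.card_range]; omega, fun j hj => ?_⟩
    rw [Finset.mem_range]
    by_contra hj3
    exact hex ⟨j, not_lt.1 hj3, hj⟩

/-- The bound for the discretised Moser sum. -/
def moserSum : ℝ≥0∞ := ∑' n : ℕ, (16 * (n + 1) : ℕ) * ENNReal.ofReal (exp (-n))

theorem moserSum_ne_top : moserSum ≠ ∞ := by
  have hs : Summable fun n : ℕ => ((16 * (n + 1) : ℕ) : ℝ) * exp (-n) := by
    have h1 := Real.summable_pow_mul_exp_neg_nat_mul 1 one_pos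
    have h0 := Real.summable_pow_mul_exp_neg_nat_mul 0 one_pos
    refine ((h1.add h0).mul_left 16).congr fun n => ?_
    push_cast
    simp
    ring
  have : moserSum = ∑' n : ℕ, ENNReal.ofReal (((16 * (n + 1) : ℕ) : ℝ) * exp (-n)) := by
    refine tsum_congr fun n => ?_
    rw [ENNReal.ofReal_mul (by positivity), ENNReal.ofReal_natCast]
  rw [this]
  exact hs.tsum_ofReal_ne_top

theorem tsum_exp_le_moserSum (hK : 0 ≤ K) (hW : ∀ j, 0 ≤ W j)
    (h : ∀ i j, i ≤ j → (W i + W j) ^ 2 ≤ 3 * (i * log 2 + K) + (j * log 2 + K)) :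
    ∑' j : ℕ, ENNReal.ofReal (exp (W j ^ 2 - (j * log 2 + K))) ≤ moserSum := by
  classical
  have hb : ∀ j : ℕ, 0 ≤ j * log 2 + K - W j ^ 2 := fun j => by
    have := h j j le_rfl
    nlinarith
  calc ∑' j : ℕ, ENNReal.ofReal (exp (W j ^ 2 - (j * log 2 + K)))
      ≤ ∑' j : ℕ, ∑' n : ℕ, if j * log 2 + K - W j ^ 2 ≤ n + 1 then
          ENNReal.ofReal (exp (-n)) else 0 := by
        refine ENNReal.tsum_le_tsum fun j => ?_
        refine le_trans ?_ (ENNReal.le_tsum ⌊j * log 2 + K - W j ^ 2⌋₊)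
        rw [if_pos (Nat.lt_floor_add_one _).le]
        refine ENNReal.ofReal_le_ofReal (exp_le_exp.2 ?_)
        have := Nat.floor_le (hb j)
        linarith
    _ = ∑' n : ℕ, ∑' j : ℕ, if j * log 2 + K - W j ^ 2 ≤ n + 1 then
          ENNReal.ofReal (exp (-n)) else 0 := ENNReal.tsum_comm
    _ ≤ moserSum := by
        refine ENNReal.tsum_le_tsum fun n => ?_
        obtain ⟨s, hs, hsj⟩ := exists_finset_of_le hK hW h n
        rw [tsum_eq_sum (s := s) fun j hj => if_neg fun hc => hj (hsj j hc)]
        calc _ ≤ ∑ j ∈ s, ENNReal.ofReal (exp (-n)) :=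
              Finset.sum_le_sum fun j _ => by split_ifs <;> simp
          _ = (s.card : ℝ≥0∞) * ENNReal.ofReal (exp (-n)) := by simp
          _ ≤ _ := by gcongr

end

/-- The constant in the exponential estimate. -/
def expBound (c : ℝ) : ℝ≥0∞ :=
  ENNReal.ofReal (exp (gramConst c / π)) * ENNReal.ofReal π +
    ENNReal.ofReal (2 * π * exp (gramConst c / π)) * moserSum

theorem expBound_ne_top (c : ℝ) : expBound c ≠ ∞ :=
  ENNReal.add_ne_top.2 ⟨ENNReal.mul_ne_top ENNReal.ofReal_ne_top ENNReal.ofReal_ne_top,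
    ENNReal.mul_ne_top ENNReal.ofReal_ne_top moserSum_ne_top⟩

/-- The levels `s` such that `|u| ≥ s` on a part of the disk of area at least `π 2⁻ʲ`. -/
def levelSet (u : E2 → ℝ) (j : ℕ) : Set ℝ :=
  {s | 0 ≤ s ∧ ENNReal.ofReal (π * 2⁻¹ ^ j) ≤ volume {x ∈ unitDisk | s ≤ |u x|}}

theorem zero_mem_levelSet (u : E2 → ℝ) (j : ℕ) : 0 ∈ levelSet u j := by
  refine ⟨le_rfl, ?_⟩
  simp only [abs_nonneg, and_true, ofPred_mem_eq, volume_unitDisk]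
  refine ENNReal.ofReal_le_ofReal (mul_le_of_le_one_right pi_pos.le ?_)
  exact pow_le_one₀ (by norm_num) (by norm_num)

theorem bddAbove_levelSet {u : E2 → ℝ} {M : ℝ} (hM : ∀ x, |u x| ≤ M) (j : ℕ) :
    BddAbove (levelSet u j) := by
  refine ⟨M, fun s hs => ?_⟩
  by_contra hc
  have : {x ∈ unitDisk | s ≤ |u x|} = ∅ := by
    ext x
    simp only [mem_ofPred_eq, mem_empty_iff_false, iff_false, not_and, not_le]
    exact fun _ => (hM x).trans_lt (not_le.1 hc)
  have h2 := hs.2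
  rw [this, measure_empty] at h2
  have : 0 < ENNReal.ofReal (π * 2⁻¹ ^ j) := ENNReal.ofReal_pos.2 (by positivity)
  exact absurd h2 (not_le.2 this)

theorem volume_sSup_levelSet_lt_le {u : E2 → ℝ} {M : ℝ} (hM : ∀ x, |u x| ≤ M) (j : ℕ) :
    volume {x ∈ unitDisk | sSup (levelSet u j) < |u x|} ≤ ENNReal.ofReal (π * 2⁻¹ ^ j) := by
  set w := sSup (levelSet u j) with hw
  have hw0 : 0 ≤ w := le_csSup (bddAbove_levelSet hM j) (zero_mem_levelSet u j)
  have hU : {x ∈ unitDisk | w < |u x|} = ⋃ n : ℕ, {x ∈ unitDisk | w + 1 / ((n : ℝ) + 1) ≤ |u x|} := by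
    ext x
    simp only [mem_ofPred_eq, mem_iUnion]
    constructor
    · rintro ⟨hx, hlt⟩
      obtain ⟨n, hn⟩ := exists_nat_one_div_lt (sub_pos.2 hlt)
      exact ⟨n, hx, by linarith⟩
    · rintro ⟨n, hx, hle⟩
      have : (0 : ℝ) < 1 / ((n : ℝ) + 1) := by positivity
      exact ⟨hx, by linarith⟩
  have hmono : Monotone fun n : ℕ => {x ∈ unitDisk | w + 1 / ((n : ℝ) + 1) ≤ |u x|} := by
    intro m n hmn x hx
    refine ⟨hx.1, le_trans ?_ hx.2⟩
    have : (1 : ℝ) / ((n : ℝ) + 1) ≤ 1 / ((m : ℝ) + 1) := by gcongr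
    linarith
  rw [hU, hmono.measure_iUnion]
  refine iSup_le fun n => ?_
  by_contra hc
  have hpos : (0 : ℝ) < 1 / ((n : ℝ) + 1) := by positivity
  have := le_csSup (bddAbove_levelSet hM j)
    (show w + 1 / ((n : ℝ) + 1) ∈ levelSet u j from ⟨by positivity, (not_le.1 hc).le⟩)
  linarith

theorem lintegral_exp_le_expBound {c : ℝ} (hc : 0 ≤ c) {u : E2 → ℝ} (hum : Measurable u) {M : ℝ}
    (hM : ∀ x, |u x| ≤ M) {f : E2 → ℝ≥0∞} (hf : Measurable f)
    (hf1 : ∫⁻ y in unitDisk, f y ^ 2 ≤ 1)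
    (hu : ∀ x ∈ unitDisk, ENNReal.ofReal (2 * π) * ‖u x‖ₑ ≤
      ∫⁻ y in unitDisk, f y * rieszKernel c x y) :
    ∫⁻ x in unitDisk, ENNReal.ofReal (exp (4 * π * u x ^ 2)) ≤ expBound c := by
  have hBm : MeasurableSet unitDisk := Metric.isOpen_ball.measurableSet
  set w : ℕ → ℝ := fun j => sSup (levelSet u j) with hw
  have hw0 : ∀ j, 0 ≤ w j := fun j =>
    le_csSup (bddAbove_levelSet hM j) (zero_mem_levelSet u j)
  set K : ℝ := gramConst c / π with hKdef
  have hK : 0 ≤ K := by rw [hKdef]; unfold gramConst; positivity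
  have hlog : ∀ j : ℕ, 2 * log (1 / √(2⁻¹ ^ j)) = j * log 2 := fun j => by
    rw [one_div, Real.log_inv, Real.log_sqrt (by positivity), Real.log_pow, Real.log_inv]
    ring
  have hpair : ∀ i j, (w i + w j) ^ 2 * (4 * π) ≤ 3 * (i * log 2 + K) + (j * log 2 + K) := by
    intro i j
    have hl2 : 0 ≤ log 2 := Real.log_nonneg (by norm_num)
    have hR : 0 ≤ (3 * (i * log 2 + K) + (j * log 2 + K)) / (4 * π) := by positivity
    have hs : ∀ s ∈ levelSet u i, ∀ s' ∈ levelSet u j,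
        s + s' ≤ √((3 * (i * log 2 + K) + (j * log 2 + K)) / (4 * π)) := by
      intro s hs s' hs'
      have hm : ∀ t : ℝ, MeasurableSet {x ∈ unitDisk | t ≤ |u x|} := fun t =>
        hBm.inter (measurableSet_le measurable_const hum.abs)
      have hρ : ∀ k : ℕ, 0 < √((2 : ℝ)⁻¹ ^ k) := fun k => Real.sqrt_pos.2 (by positivity)
      have hρ1 : ∀ k : ℕ, √((2 : ℝ)⁻¹ ^ k) ≤ 1 := fun k =>
        Real.sqrt_le_one.2 (pow_le_one₀ (by norm_num) (by norm_num))
      have hρ2 : ∀ k : ℕ, √((2 : ℝ)⁻¹ ^ k) ^ 2 = 2⁻¹ ^ k := fun k =>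
        Real.sq_sqrt (by positivity)
      have := two_level_le hc hf hf1 hu (hm s) (hm s') (fun x hx => hx.1) (fun x hx => hx.1)
        (hρ i) (hρ j) (hρ1 i) (hρ1 j) (by rw [hρ2]; exact hs.2) (by rw [hρ2]; exact hs'.2)
        hs.1 hs'.1 (fun x hx => hx.2) (fun x hx => hx.2)
      rw [hlog, hlog] at this
      refine Real.le_sqrt_of_sq_le ?_
      rw [le_div_iff₀ (by positivity)]
      linarith
    have h1 : ∀ s' ∈ levelSet u j,
        w i ≤ √((3 * (i * log 2 + K) + (j * log 2 + K)) / (4 * π)) - s' := fun s' hs' =>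
      csSup_le ⟨0, zero_mem_levelSet u i⟩ fun s h => by linarith [hs s h s' hs']
    have h2 : w j ≤ √((3 * (i * log 2 + K) + (j * log 2 + K)) / (4 * π)) - w i :=
      csSup_le ⟨0, zero_mem_levelSet u j⟩ fun s' h => by linarith [h1 s' h]
    rw [← le_div_iff₀ (by positivity)]
    exact (Real.le_sqrt (add_nonneg (hw0 i) (hw0 j)) hR).1 (by linarith)
  set W : ℕ → ℝ := fun j => √(4 * π) * w j with hW
  have hsq : √(4 * π) ^ 2 = 4 * π := Real.sq_sqrt (by positivity)
  have hsum := tsum_exp_le_moserSum (K := K) (W := W) hK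
    (fun j => mul_nonneg (Real.sqrt_nonneg _) (hw0 j)) (fun i j _ => by
      rw [hW, ← mul_add, mul_pow, hsq, mul_comm]
      exact hpair i j)
  have hpt : ∀ x, ENNReal.ofReal (exp (4 * π * u x ^ 2)) ≤ ENNReal.ofReal (exp K) +
      ∑' j : ℕ, {y | w j < |u y|}.indicator
        (fun _ => ENNReal.ofReal (exp (4 * π * w (j + 1) ^ 2))) x := by
    classical
    intro x
    by_cases hex : ∃ j, |u x| ≤ w j
    · have hspec := Nat.find_spec hex
      have hmin := fun m => Nat.find_min hex (m := m)
      have hle : ∀ k, |u x| ≤ w k → 4 * π * u x ^ 2 ≤ 4 * π * w k ^ 2 := fun k hk => by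
        rw [← sq_abs (u x)]; gcongr
      rcases hk : Nat.find hex with _ | k
      · rw [hk] at hspec
        refine le_add_right (ENNReal.ofReal_le_ofReal (exp_le_exp.2 ((hle _ hspec).trans ?_)))
        have := hpair 0 0
        simp only [Nat.cast_zero, zero_mul, zero_add] at this
        nlinarith
      · rw [hk] at hspec
        have hlt : w k < |u x| := not_le.1 (hmin k (by omega))
        refine le_add_left (le_trans ?_ (ENNReal.le_tsum k))
        rw [indicator_of_mem (show x ∈ {y | w k < |u y|} from hlt)]
        exact ENNReal.ofReal_le_ofReal (exp_le_exp.2 (hle _ hspec))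
    · push Not at hex
      have : ∑' j : ℕ, {y | w j < |u y|}.indicator
          (fun _ => ENNReal.ofReal (exp (4 * π * w (j + 1) ^ 2))) x = ∞ := by
        refine top_unique ?_
        rw [← ENNReal.tsum_const_eq_top_of_ne_zero (α := ℕ) one_ne_zero]
        refine ENNReal.tsum_le_tsum fun j => ?_
        rw [indicator_of_mem (show x ∈ {y | w j < |u y|} from hex j), ← ENNReal.ofReal_one]
        exact ENNReal.ofReal_le_ofReal (one_le_exp (by positivity))
      rw [this]; simp
  have hms : ∀ j, MeasurableSet {y | w j < |u y|} := fun j =>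
    measurableSet_lt measurable_const hum.abs
  calc ∫⁻ x in unitDisk, ENNReal.ofReal (exp (4 * π * u x ^ 2))
      ≤ ∫⁻ x in unitDisk, (ENNReal.ofReal (exp K) + ∑' j : ℕ, {y | w j < |u y|}.indicator
        (fun _ => ENNReal.ofReal (exp (4 * π * w (j + 1) ^ 2))) x) := lintegral_mono hpt
    _ = ENNReal.ofReal (exp K) * ENNReal.ofReal π + ∑' j : ℕ,
        ENNReal.ofReal (exp (4 * π * w (j + 1) ^ 2)) *
          volume {x ∈ unitDisk | w j < |u x|} := by
        rw [lintegral_add_left measurable_const, setLIntegral_const, volume_unitDisk,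
          lintegral_tsum fun j => (measurable_const.indicator (hms j)).aemeasurable]
        congr 1
        refine tsum_congr fun j => ?_
        rw [lintegral_indicator (hms j), Measure.restrict_restrict (hms j), setLIntegral_const,
          inter_comm]
        rfl
    _ ≤ ENNReal.ofReal (exp K) * ENNReal.ofReal π + ∑' j : ℕ,
        ENNReal.ofReal (2 * π * exp K) *
          ENNReal.ofReal (exp (W (j + 1) ^ 2 - ((j + 1 : ℕ) * log 2 + K))) := by
        refine add_le_add le_rfl (ENNReal.tsum_le_tsum fun j => ?_)
        calc _ ≤ ENNReal.ofReal (exp (4 * π * w (j + 1) ^ 2)) * ENNReal.ofReal (π * 2⁻¹ ^ j) :=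
              mul_le_mul_right (volume_sSup_levelSet_lt_le hM j) _
          _ = ENNReal.ofReal (2 * π * exp K) *
              ENNReal.ofReal (exp (W (j + 1) ^ 2 - ((j + 1 : ℕ) * log 2 + K))) := by
              rw [← ENNReal.ofReal_mul (by positivity), ← ENNReal.ofReal_mul (by positivity), hW,
                mul_pow, hsq, exp_sub, exp_add, Real.exp_nat_mul, Real.exp_log two_pos, inv_pow]
              congr 1
              field_simp
              ring
    _ ≤ expBound c := by
        rw [ENNReal.tsum_mul_left, expBound]
        gcongr
        refine le_trans ?_ hsum
        exact ENNReal.tsum_comp_le_tsum_of_injective (f := fun j : ℕ => j + 1)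
          (add_left_injective 1) (fun j => ENNReal.ofReal (exp (W j ^ 2 - (j * log 2 + K))))

/-- Coefficients of `besselSeries`. -/
def besselCoeff (k n : ℕ) : ℝ := (-1) ^ (n + k) / (n.factorial * (n + k).factorial)

/-- The `k`-th derivative of the entire function `∑ (-s)ⁿ / (n!)²`, which is `J₀(2 √s)`
for `s ≥ 0`. -/
def besselSeries (k : ℕ) (s : ℝ) : ℝ := ∑' n, besselCoeff k n * s ^ n

theorem besselCoeff_succ_mul (k n : ℕ) :
    besselCoeff k (n + 1) * ((n + 1 : ℕ) : ℝ) = besselCoeff (k + 1) n := by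
  unfold besselCoeff
  rw [show n + 1 + k = n + (k + 1) by ring, Nat.factorial_succ n]
  push_cast
  field_simp

theorem abs_besselCoeff_le (k n : ℕ) : |besselCoeff k n| ≤ ((n.factorial : ℝ))⁻¹ := by
  unfold besselCoeff
  rw [abs_div, abs_pow, abs_neg, abs_one, one_pow, abs_of_nonneg (by positivity), one_div]
  gcongr
  exact le_mul_of_one_le_right (by positivity) (by exact_mod_cast (n + k).factorial_pos)

theorem summable_besselCoeff_mul_pow (k : ℕ) (s : ℝ) :
    Summable fun n => besselCoeff k n * s ^ n := by
  refine Summable.of_norm_bounded (Real.summable_pow_div_factorial |s|) fun n => ?_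
  rw [norm_mul, norm_pow, Real.norm_eq_abs, Real.norm_eq_abs, div_eq_inv_mul]
  gcongr
  exact abs_besselCoeff_le k n

theorem hasDerivAt_besselSeries (k : ℕ) (s : ℝ) :
    HasDerivAt (besselSeries k) (besselSeries (k + 1) s) s := by
  set R : ℝ := |s| + 1 with hR
  have hR0 : 0 ≤ R := by positivity
  have hu : Summable fun n : ℕ => ((n.factorial : ℝ))⁻¹ * (n * R ^ (n - 1)) := by
    rw [← summable_nat_add_iff 1]
    refine (Real.summable_pow_div_factorial R).congr fun n => ?_
    rw [Nat.factorial_succ]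
    push_cast
    field_simp
  have key := hasDerivAt_tsum_of_isPreconnected (𝕜 := ℝ) (t := Metric.ball 0 R)
    (g := fun n s => besselCoeff k n * s ^ n)
    (g' := fun n s => besselCoeff k n * (n * s ^ (n - 1))) (y₀ := 0) (y := s) hu
    Metric.isOpen_ball (convex_ball 0 R).isPreconnected
    (fun n y _ => (hasDerivAt_pow n y).const_mul _)
    (fun n y hy => by
      rw [mem_ball_zero_iff, Real.norm_eq_abs] at hy
      rw [norm_mul, norm_mul, norm_pow, Real.norm_eq_abs, Real.norm_eq_abs, Real.norm_eq_abs,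
        Nat.abs_cast]
      gcongr
      exact abs_besselCoeff_le k n)
    (by simp [hR]; positivity) (summable_besselCoeff_mul_pow k 0)
    (by simp [hR])
  have hs : Summable fun n => besselCoeff k n * (n * s ^ (n - 1)) := by
    rw [← summable_nat_add_iff 1]
    refine (summable_besselCoeff_mul_pow (k + 1) s).congr fun n => ?_
    rw [← besselCoeff_succ_mul, Nat.add_sub_cancel, mul_assoc]
  rw [hs.tsum_eq_zero_add] at key
  simp only [Nat.cast_zero, zero_mul, mul_zero, zero_add, Nat.add_sub_cancel, ← mul_assoc,
    besselCoeff_succ_mul] at key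
  exact key

theorem contDiff_besselSeries (k : ℕ) : ContDiff ℝ (⊤ : ℕ∞) (besselSeries k) := by
  rw [contDiff_infty]
  intro n
  induction n generalizing k with
  | zero =>
    exact contDiff_zero.2 (continuous_iff_continuousAt.2 fun s =>
      (hasDerivAt_besselSeries k s).continuousAt)
  | succ n ih =>
    have hd : deriv (besselSeries k) = besselSeries (k + 1) :=
      funext fun s => (hasDerivAt_besselSeries k s).deriv
    exact contDiff_succ_iff_deriv.2
      ⟨fun s => (hasDerivAt_besselSeries k s).differentiableAt, by simp, hd ▸ ih (k + 1)⟩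

theorem besselSeries_zero_zero : besselSeries 0 0 = 1 := by
  unfold besselSeries
  rw [tsum_eq_single 0 fun n hn => by simp [hn]]
  simp [besselCoeff]

theorem besselSeries_ode (s : ℝ) :
    s * besselSeries 2 s + besselSeries 1 s + besselSeries 0 s = 0 := by
  have h1 := summable_besselCoeff_mul_pow 1 s
  have h0 := summable_besselCoeff_mul_pow 0 s
  have h2 := (summable_besselCoeff_mul_pow 2 s).mul_left s
  unfold besselSeries
  rw [add_assoc, ← h1.tsum_add h0, (h1.add h0).tsum_eq_zero_add, ← tsum_mul_left,
    add_left_comm, ← h2.tsum_add ((summable_nat_add_iff 1).2 (h1.add h0))]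
  have : ∀ n, s * (besselCoeff 2 n * s ^ n) +
      (besselCoeff 1 (n + 1) * s ^ (n + 1) + besselCoeff 0 (n + 1) * s ^ (n + 1)) = 0 := by
    intro n
    have : besselCoeff 2 n + besselCoeff 1 (n + 1) + besselCoeff 0 (n + 1) = 0 := by
      unfold besselCoeff
      rw [show n + 1 + 1 = n + 2 by ring, show n + 1 + 0 = n + 1 by ring,
        Nat.factorial_succ (n + 1), Nat.factorial_succ n]
      push_cast
      field_simp
      ring
    rw [pow_succ]
    linear_combination (s * s ^ n) * this
  simp only [this, tsum_zero]
  simp [besselCoeff]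

theorem norm_smul_add_smul_innerSL_sq {H : Type*} [NormedAddCommGroup H] [InnerProductSpace ℝ H]
    [CompleteSpace H] (A : H →L[ℝ] ℝ) (z : H) (a b : ℝ) :
    ‖a • A + b • innerSL ℝ z‖ ^ 2 = a ^ 2 * ‖A‖ ^ 2 + 2 * a * b * A z + b ^ 2 * ‖z‖ ^ 2 := by
  obtain ⟨w, rfl⟩ := (InnerProductSpace.toDual ℝ H).surjective A
  have : a • InnerProductSpace.toDual ℝ H w + b • innerSL ℝ z =
      InnerProductSpace.toDual ℝ H (a • w + b • z) := by
    ext; simp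
  rw [this, LinearIsometryEquiv.norm_map, LinearIsometryEquiv.norm_map, norm_add_sq_real,
    norm_smul, norm_smul, mul_pow, mul_pow, inner_smul_left, inner_smul_right]
  simp
  ring

/-- The radial solution of `-Δφ = 4cφ` with `φ(0) = 1`. -/
def groundState (c : ℝ) (x : E2) : ℝ := besselSeries 0 (c * ‖x‖ ^ 2)

/-- The gradient of `groundState`. -/
def gradGroundState (c : ℝ) (x : E2) : E2 := (2 * c * besselSeries 1 (c * ‖x‖ ^ 2)) • x

theorem contDiff_groundState (c : ℝ) : ContDiff ℝ (⊤ : ℕ∞) (groundState c) :=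
  (contDiff_besselSeries 0).comp (contDiff_const.mul (contDiff_norm_sq ℝ))

theorem hasFDerivAt_besselSeries_norm_sq (k : ℕ) (c : ℝ) (x : E2) :
    HasFDerivAt (fun x : E2 => besselSeries k (c * ‖x‖ ^ 2))
      ((2 * c * besselSeries (k + 1) (c * ‖x‖ ^ 2)) • innerSL ℝ x) x := by
  have h := (hasDerivAt_besselSeries k (c * ‖x‖ ^ 2)).comp_hasFDerivAt x
    ((hasStrictFDerivAt_norm_sq x).hasFDerivAt.const_mul c)
  refine h.congr_fderiv ?_
  ext y
  simp
  ring

theorem hasFDerivAt_groundState (c : ℝ) (x : E2) :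
    HasFDerivAt (groundState c) (innerSL ℝ (gradGroundState c x)) x := by
  refine (hasFDerivAt_besselSeries_norm_sq 0 c x).congr_fderiv ?_
  ext y
  simp [gradGroundState]

theorem integral_fderiv_gradGroundState (c : ℝ) {g : E2 → ℝ} (hg : ContDiff ℝ 1 g)
    (hc : HasCompactSupport g) :
    ∫ x, fderiv ℝ g x (gradGroundState c x) = 4 * c * ∫ x, groundState c x * g x := by
  set e : Fin 2 → E2 := fun i => EuclideanSpace.single i 1 with he
  have hB : ∀ k, Continuous fun x : E2 => besselSeries k (c * ‖x‖ ^ 2) := fun k =>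
    (contDiff_besselSeries k).continuous.comp (by fun_prop)
  have hcoord : ∀ i : Fin 2, Continuous fun x : E2 => x i := fun i => by fun_prop
  have hgc := hg.continuous
  have hdc : Continuous (fderiv ℝ g) := hg.continuous_fderiv one_ne_zero
  have hcd : ∀ i, HasCompactSupport fun x => fderiv ℝ g x (e i) := fun i =>
    (hc.fderiv (𝕜 := ℝ)).comp_left (g := fun L : E2 →L[ℝ] ℝ => L (e i)) rfl
  have hP : ∀ (i : Fin 2) (x : E2), HasFDerivAt (fun x : E2 => besselSeries 1 (c * ‖x‖ ^ 2) * x i)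
      (besselSeries 1 (c * ‖x‖ ^ 2) • (EuclideanSpace.proj i : E2 →L[ℝ] ℝ) +
        x i • (2 * c * besselSeries 2 (c * ‖x‖ ^ 2)) • innerSL ℝ x) x := fun i x =>
    (hasFDerivAt_besselSeries_norm_sq 1 c x).mul (EuclideanSpace.proj i : E2 →L[ℝ] ℝ).hasFDerivAt
  have hPe : ∀ (i : Fin 2) (x : E2),
      fderiv ℝ (fun x : E2 => besselSeries 1 (c * ‖x‖ ^ 2) * x i) x (e i) =
        besselSeries 1 (c * ‖x‖ ^ 2) + 2 * c * besselSeries 2 (c * ‖x‖ ^ 2) * x i ^ 2 := by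
    intro i x
    rw [(hP i x).fderiv]
    simp [he, EuclideanSpace.inner_single_right]
    ring
  have hI1 : ∀ i, Integrable fun x => (besselSeries 1 (c * ‖x‖ ^ 2) * x i) * fderiv ℝ g x (e i) :=
    fun i => (((hB 1).mul (hcoord i)).mul (hdc.clm_apply continuous_const)
      ).integrable_of_hasCompactSupport (hcd i).mul_left
  have hI2 : ∀ i : Fin 2, Integrable fun x : E2 => (besselSeries 1 (c * ‖x‖ ^ 2) +
      2 * c * besselSeries 2 (c * ‖x‖ ^ 2) * x i ^ 2) * g x := fun i =>
    (((hB 1).add ((continuous_const.mul (hB 2)).mul ((hcoord i).pow 2))).mul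
      hgc).integrable_of_hasCompactSupport hc.mul_left
  have hibp : ∀ i, ∫ x, (besselSeries 1 (c * ‖x‖ ^ 2) * x i) * fderiv ℝ g x (e i) =
      -∫ x : E2, (besselSeries 1 (c * ‖x‖ ^ 2) + 2 * c * besselSeries 2 (c * ‖x‖ ^ 2) * x i ^ 2) *
        g x := by
    intro i
    have := integral_mul_fderiv_eq_neg_fderiv_mul_of_integrable (μ := volume) (v := e i)
      (f := fun x : E2 => besselSeries 1 (c * ‖x‖ ^ 2) * x i) (g := g)
      (by simpa only [hPe] using hI2 i) (hI1 i)
      ((((hB 1).mul (hcoord i)).mul hgc).integrable_of_hasCompactSupport hc.mul_left)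
      (fun x _ => (hP i x).differentiableAt) (fun x _ => hg.differentiable one_ne_zero x)
    simpa only [hPe] using this
  have hsum : ∀ x : E2, x = x 0 • e 0 + x 1 • e 1 := fun x => by
    ext i; fin_cases i <;> simp [he]
  calc ∫ x, fderiv ℝ g x (gradGroundState c x)
      = ∫ x, 2 * c * ((besselSeries 1 (c * ‖x‖ ^ 2) * x 0) * fderiv ℝ g x (e 0) +
          (besselSeries 1 (c * ‖x‖ ^ 2) * x 1) * fderiv ℝ g x (e 1)) := by
        refine integral_congr_ae (.of_forall fun x => ?_)
        simp only [gradGroundState, map_smul, smul_eq_mul]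
        conv_lhs => rw [show fderiv ℝ g x x = fderiv ℝ g x (x 0 • e 0 + x 1 • e 1) by rw [← hsum]]
        simp only [map_add, map_smul, smul_eq_mul]
        ring
    _ = 4 * c * ∫ x, groundState c x * g x := by
        rw [integral_const_mul, integral_add (hI1 0) (hI1 1), hibp, hibp, ← neg_add,
          ← integral_add (hI2 0) (hI2 1), ← integral_neg, ← integral_const_mul,
          ← integral_const_mul]
        refine integral_congr_ae (.of_forall fun x => ?_)
        have hn : ‖x‖ ^ 2 = x 0 ^ 2 + x 1 ^ 2 := by
          rw [EuclideanSpace.norm_sq_eq]; simp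
        have hode := besselSeries_ode (c * ‖x‖ ^ 2)
        simp only [groundState]
        have : 2 * c * besselSeries 2 (c * ‖x‖ ^ 2) * ‖x‖ ^ 2 =
          2 * c * besselSeries 2 (c * ‖x‖ ^ 2) * (x 0 ^ 2 + x 1 ^ 2) := by rw [← hn]
        linear_combination (-4 * c * g x) * hode + 2 * c * g x * this

theorem integral_norm_fderiv_groundState_mul_sq (c : ℝ) {v : E2 → ℝ} (hv : ContDiff ℝ 1 v)
    (hc : HasCompactSupport v) :
    ∫ x, ‖fderiv ℝ (fun x => groundState c x * v x) x‖ ^ 2 =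
      4 * c * (∫ x, (groundState c x * v x) ^ 2) +
        ∫ x, groundState c x ^ 2 * ‖fderiv ℝ v x‖ ^ 2 := by
  have hφ : ContDiff ℝ 1 (groundState c) := (contDiff_groundState c).of_le (by simp)
  set g : E2 → ℝ := fun x => groundState c x * v x ^ 2 with hg
  have hgd : ContDiff ℝ 1 g := hφ.mul (hv.pow 2)
  have hgc : HasCompactSupport g :=
    (hc.comp_left (g := fun t : ℝ => t ^ 2) (by norm_num)).mul_left
  have hpt : ∀ x, ‖fderiv ℝ (fun x => groundState c x * v x) x‖ ^ 2 =
      fderiv ℝ g x (gradGroundState c x) + groundState c x ^ 2 * ‖fderiv ℝ v x‖ ^ 2 := by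
    intro x
    have hvx := (hv.differentiable one_ne_zero x).hasFDerivAt
    have h1 := (hasFDerivAt_groundState c x).mul hvx
    have h2 := (hasFDerivAt_groundState c x).mul (hvx.pow 2)
    have e1 : fderiv ℝ (fun x => groundState c x * v x) x = _ := h1.fderiv
    have e2 : fderiv ℝ g x = _ := h2.fderiv
    rw [e1, e2, norm_smul_add_smul_innerSL_sq]
    simp
    ring
  have hI1 : Integrable fun x => fderiv ℝ g x (gradGroundState c x) := by
    refine Continuous.integrable_of_hasCompactSupport ?_ ?_
    · refine (hgd.continuous_fderiv one_ne_zero).clm_apply ?_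
      exact (continuous_const.mul ((contDiff_besselSeries 1).continuous.comp
        (by fun_prop))).smul continuous_id
    · exact (hgc.fderiv (𝕜 := ℝ)).mono fun x hx h0 => hx (by simp [h0])
  have hI2 : Integrable fun x => groundState c x ^ 2 * ‖fderiv ℝ v x‖ ^ 2 := by
    refine Continuous.integrable_of_hasCompactSupport ?_ ?_
    · exact (hφ.continuous.pow 2).mul ((hv.continuous_fderiv one_ne_zero).norm.pow 2)
    · exact ((hc.fderiv (𝕜 := ℝ)).comp_left (g := fun L => ‖L‖ ^ 2) (by simp)).mul_left
  simp only [hpt]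
  rw [integral_add hI1 hI2, integral_fderiv_gradGroundState c hgd hgc]
  congr 3
  exact funext fun x => by rw [hg]; ring

theorem setIntegral_sq_of_isTestFun {Ω : Set E2} {u : E2 → ℝ} (hu : IsTestFun Ω u) :
    ∫ x in Ω, u x ^ 2 = ∫ x, u x ^ 2 :=
  setIntegral_eq_integral_of_forall_compl_eq_zero fun x hx => by
    rw [image_eq_zero_of_notMem_tsupport fun h => hx (hu.2.2 h)]; norm_num

theorem fderiv_eq_zero_of_isTestFun {Ω : Set E2} {u : E2 → ℝ} (hu : IsTestFun Ω u) {x : E2}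
    (hx : x ∉ Ω) : fderiv ℝ u x = 0 := by
  by_contra h
  exact hx (hu.2.2 (support_fderiv_subset ℝ h))

theorem setIntegral_norm_fderiv_sq_of_isTestFun {Ω : Set E2} {u : E2 → ℝ} (hu : IsTestFun Ω u) :
    ∫ x in Ω, ‖fderiv ℝ u x‖ ^ 2 = ∫ x, ‖fderiv ℝ u x‖ ^ 2 :=
  setIntegral_eq_integral_of_forall_compl_eq_zero fun x hx => by
    rw [fderiv_eq_zero_of_isTestFun hu hx]; simp

theorem lambda1_mul_integral_sq_le {u : E2 → ℝ} (hu : IsTestFun unitDisk u) :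
    lambda1 * ∫ x in unitDisk, u x ^ 2 ≤ ∫ x in unitDisk, ‖fderiv ℝ u x‖ ^ 2 := by
  have hD : 0 ≤ ∫ x in unitDisk, ‖fderiv ℝ u x‖ ^ 2 := integral_nonneg fun x => by positivity
  have hI : 0 ≤ ∫ x in unitDisk, u x ^ 2 := integral_nonneg fun x => by positivity
  rcases hI.eq_or_lt with h0 | hpos
  · rw [← h0, mul_zero]; exact hD
  · rw [← le_div_iff₀ hpos]
    refine csInf_le ⟨0, ?_⟩ ⟨u, hu, fun h => ?_, rfl⟩
    · rintro _ ⟨w, -, -, rfl⟩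
      exact div_nonneg (integral_nonneg fun x => by positivity)
        (integral_nonneg fun x => by positivity)
    · simp [h] at hpos

theorem deriv_smoothTransition_eq_zero {t : ℝ} (ht : t < 0 ∨ 1 < t) :
    deriv smoothTransition t = 0 := by
  rcases ht with ht | ht
  · have : smoothTransition =ᶠ[nhds t] fun _ => 0 := by
      filter_upwards [Iio_mem_nhds ht] with y hy using smoothTransition.zero_of_nonpos (le_of_lt hy)
    rw [this.deriv_eq, deriv_const]
  · have : smoothTransition =ᶠ[nhds t] fun _ => 1 := by
      filter_upwards [Ioi_mem_nhds ht] with y hy using smoothTransition.one_of_one_le (le_of_lt hy)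
    rw [this.deriv_eq, deriv_const]

theorem exists_abs_deriv_smoothTransition_le : ∃ C, ∀ t, |deriv smoothTransition t| ≤ C := by
  have hc : Continuous (deriv smoothTransition) :=
    (smoothTransition.contDiff (n := 1)).continuous_deriv le_rfl
  obtain ⟨C, hC⟩ := isCompact_Icc.exists_bound_of_continuousOn (s := Icc (0 : ℝ) 1) hc.continuousOn
  refine ⟨C, fun t => ?_⟩
  by_cases ht : t ∈ Icc (0 : ℝ) 1
  · exact hC t ht
  · rw [deriv_smoothTransition_eq_zero, abs_zero]
    · exact (norm_nonneg _).trans (hC 0 (by simp))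
    · by_contra! h
      exact ht h

/-- A smooth radial cutoff between the circles `c‖x‖² = s - 2ε` and `c‖x‖² = s - ε`. -/
def radialCutoff (s c ε : ℝ) (x : E2) : ℝ := smoothTransition ((s - c * ‖x‖ ^ 2) / ε - 1)

section radialCutoff

variable {s c ε : ℝ}

theorem contDiff_radialCutoff : ContDiff ℝ (⊤ : ℕ∞) (radialCutoff s c ε) :=
  smoothTransition.contDiff.comp
    (((contDiff_const.sub (contDiff_const.mul (contDiff_norm_sq ℝ))).div_const ε).sub
      contDiff_const)

theorem fderiv_radialCutoff (x : E2) : fderiv ℝ (radialCutoff s c ε) x =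
    (deriv smoothTransition ((s - c * ‖x‖ ^ 2) / ε - 1) * (-(2 * c / ε))) • innerSL ℝ x := by
  have h1 := ((((hasStrictFDerivAt_norm_sq x).hasFDerivAt.const_mul c).const_sub s).mul_const
    ε⁻¹).sub_const 1
  have h2 := (((smoothTransition.contDiff (n := 1)).differentiable one_ne_zero
    ((s - c * ‖x‖ ^ 2) * ε⁻¹ - 1)).hasDerivAt).comp_hasFDerivAt x h1
  have h3 : fderiv ℝ (radialCutoff s c ε) x = _ := HasFDerivAt.fderiv h2
  rw [h3]
  ext y
  simp [div_eq_mul_inv]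
  ring

theorem tsupport_radialCutoff_subset (hc : 0 < c) (hε : 0 < ε) :
    tsupport (radialCutoff s c ε) ⊆ Metric.closedBall 0 √((s - ε) / c) := by
  refine closure_minimal (fun x hx => ?_) Metric.isClosed_closedBall
  have h1 : 0 < (s - c * ‖x‖ ^ 2) / ε - 1 := by
    by_contra h
    exact hx (smoothTransition.zero_of_nonpos (not_lt.1 h))
  have h2 : ε < s - c * ‖x‖ ^ 2 := by
    rw [sub_pos, one_lt_div hε] at h1; exact h1
  rw [mem_closedBall_zero_iff]
  refine Real.le_sqrt_of_sq_le ?_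
  rw [le_div_iff₀ hc]
  linarith

theorem hasCompactSupport_radialCutoff (hc : 0 < c) (hε : 0 < ε) :
    HasCompactSupport (radialCutoff s c ε) :=
  (isCompact_closedBall _ _).of_isClosed_subset (isClosed_tsupport _)
    (tsupport_radialCutoff_subset hc hε)

theorem isTestFun_groundState_mul_radialCutoff (hc : 0 < c) (hs : s ≤ c) (hε : 0 < ε) :
    IsTestFun unitDisk fun x => groundState c x * radialCutoff s c ε x := by
  refine ⟨(contDiff_groundState c).mul contDiff_radialCutoff,
    (hasCompactSupport_radialCutoff hc hε).mul_left, ?_⟩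
  refine (tsupport_mul_subset_right.trans (tsupport_radialCutoff_subset hc hε)).trans
    (Metric.closedBall_subset_ball ?_)
  rw [Real.sqrt_lt' one_pos, div_lt_iff₀ hc]
  linarith

/-- The closed annulus carrying the gradient of `radialCutoff`. -/
def transitionAnnulus (s c ε : ℝ) : Set E2 :=
  {x | ε ≤ s - c * ‖x‖ ^ 2 ∧ s - c * ‖x‖ ^ 2 ≤ 2 * ε}

theorem measurableSet_transitionAnnulus : MeasurableSet (transitionAnnulus s c ε) := by
  have : Measurable fun x : E2 => s - c * ‖x‖ ^ 2 := by fun_prop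
  exact (measurableSet_le measurable_const this).inter (measurableSet_le this measurable_const)

theorem transitionAnnulus_subset (hc : 0 < c) : transitionAnnulus s c ε ⊆
    Metric.closedBall 0 √((s - ε) / c) \ Metric.ball 0 √((s - 2 * ε) / c) := by
  rintro x ⟨h1, h2⟩
  refine ⟨?_, fun h => ?_⟩
  · rw [mem_closedBall_zero_iff]
    refine Real.le_sqrt_of_sq_le ?_
    rw [le_div_iff₀ hc]
    linarith
  · rw [mem_ball_zero_iff, Real.lt_sqrt (norm_nonneg x), lt_div_iff₀ hc] at h
    linarith

theorem volume_transitionAnnulus_le (hc : 0 < c) (hε0 : 0 < ε) (hε : 2 * ε ≤ s) :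
    volume.real (transitionAnnulus s c ε) ≤ π * ε / c := by
  have hsub : Metric.ball (0 : E2) √((s - 2 * ε) / c) ⊆ Metric.closedBall 0 √((s - ε) / c) :=
    Metric.ball_subset_closedBall.trans (Metric.closedBall_subset_closedBall
      (Real.sqrt_le_sqrt (by gcongr; linarith)))
  have hvol : ∀ r : ℝ, 0 ≤ r → volume.real (Metric.ball (0 : E2) √(r / c)) = r / c * π := by
    intro r hr
    rw [Measure.real, EuclideanSpace.volume_ball_fin_two, ← ENNReal.ofReal_pow (by positivity),
      Real.sq_sqrt (by positivity), ← ENNReal.ofReal_mul (by positivity),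
      ENNReal.toReal_ofReal (by positivity)]
  calc volume.real (transitionAnnulus s c ε)
      ≤ volume.real (Metric.closedBall (0 : E2) √((s - ε) / c) \
          Metric.ball 0 √((s - 2 * ε) / c)) :=
        measureReal_mono (transitionAnnulus_subset hc)
          (measure_ne_top_of_subset sdiff_subset measure_closedBall_lt_top.ne)
    _ = π * ε / c := by
        rw [measureReal_sdiff hsub Metric.isOpen_ball.measurableSet measure_closedBall_lt_top.ne,
          Measure.real, Measure.addHaar_closedBall_eq_addHaar_ball]
        change volume.real _ - _ = _
        rw [hvol _ (by linarith), hvol _ (by linarith)]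
        ring

end radialCutoff

/-- On a disk carrying a zero of the radial solution, cutting the solution off near its zero
circle produces a competitor with Rayleigh quotient close to `4c`. -/
theorem exists_integral_groundState_cutoff_le {s c : ℝ} (hs : 0 < s) (hsc : s ≤ c)
    (h0 : besselSeries 0 s = 0) : ∃ A : ℝ, ∀ ε, 0 < ε → 2 * ε ≤ s →
      ∫ x, groundState c x ^ 2 * ‖fderiv ℝ (radialCutoff s c ε) x‖ ^ 2 ≤ A * ε := by
  have hc : 0 < c := hs.trans_le hsc
  obtain ⟨T, hT⟩ := exists_abs_deriv_smoothTransition_le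
  have hT0 : 0 ≤ T := (abs_nonneg _).trans (hT 0)
  obtain ⟨L, hL⟩ := isCompact_Icc.exists_bound_of_continuousOn (s := Icc (0 : ℝ) s)
    (contDiff_besselSeries 1).continuous.continuousOn
  have hL0 : 0 ≤ L := (norm_nonneg _).trans (hL 0 ⟨le_rfl, hs.le⟩)
  have hlip : ∀ t ∈ Icc 0 s, |besselSeries 0 t| ≤ L * (s - t) := by
    intro t ht
    have := (convex_Icc 0 s).norm_image_sub_le_of_norm_hasDerivWithin_le
      (fun y _ => (hasDerivAt_besselSeries 0 y).hasDerivWithinAt) hL ht ⟨hs.le, le_rfl⟩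
    rwa [h0, zero_sub, norm_neg, Real.norm_eq_abs, Real.norm_of_nonneg (by linarith [ht.2])] at this
  refine ⟨(4 * L * T * c) ^ 2 * (π / c), fun ε hε hεs => ?_⟩
  have hpt : ∀ x, groundState c x ^ 2 * ‖fderiv ℝ (radialCutoff s c ε) x‖ ^ 2 ≤
      (transitionAnnulus s c ε).indicator (fun _ => (4 * L * T * c) ^ 2) x := by
    intro x
    by_cases hx : x ∈ transitionAnnulus s c ε
    · rw [indicator_of_mem hx, ← mul_pow]
      have hx1 : ‖x‖ ≤ 1 := by
        have : c * ‖x‖ ^ 2 ≤ c * 1 := by linarith [hx.1]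
        exact (sq_le_one_iff₀ (norm_nonneg x)).1 (le_of_mul_le_mul_left this hc)
      have h1 : |groundState c x| ≤ L * (2 * ε) :=
        (hlip _ ⟨by positivity, by linarith [hx.1]⟩).trans (by gcongr; exact hx.2)
      have h2 : ‖fderiv ℝ (radialCutoff s c ε) x‖ ≤ T * (2 * c / ε) * 1 := by
        rw [fderiv_radialCutoff, norm_smul, innerSL_apply_norm, norm_mul, norm_neg,
          Real.norm_of_nonneg (r := 2 * c / ε) (by positivity)]
        gcongr
        exact hT _
      refine sq_le_sq.2 ?_
      rw [abs_mul, abs_norm, abs_of_nonneg (a := 4 * L * T * c) (by positivity)]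
      calc _ ≤ L * (2 * ε) * (T * (2 * c / ε) * 1) := by gcongr
        _ = 4 * L * T * c := by field_simp; ring
    · rw [indicator_of_notMem hx, fderiv_radialCutoff, deriv_smoothTransition_eq_zero]
      · simp
      · by_contra! h
        refine hx ⟨?_, ?_⟩
        · have := h.1
          rw [sub_nonneg, one_le_div hε] at this
          exact this
        · have : (s - c * ‖x‖ ^ 2) / ε ≤ 2 := by linarith [h.2]
          rwa [div_le_iff₀ hε] at this
  calc ∫ x, groundState c x ^ 2 * ‖fderiv ℝ (radialCutoff s c ε) x‖ ^ 2
      ≤ ∫ x, (transitionAnnulus s c ε).indicator (fun _ => (4 * L * T * c) ^ 2) x := by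
        refine integral_mono_of_nonneg (.of_forall fun x => by positivity) ?_ (.of_forall hpt)
        exact (integrable_indicator_iff measurableSet_transitionAnnulus).2 (integrableOn_const
          (measure_ne_top_of_subset ((transitionAnnulus_subset hc).trans sdiff_subset)
            measure_closedBall_lt_top.ne))
    _ = (4 * L * T * c) ^ 2 * volume.real (transitionAnnulus s c ε) := by
        rw [integral_indicator_const _ measurableSet_transitionAnnulus, smul_eq_mul, mul_comm]
    _ ≤ (4 * L * T * c) ^ 2 * (π * ε / c) := by
        gcongr
        exact volume_transitionAnnulus_le hc hε hεs
    _ = _ := by ring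

theorem groundState_zero (c : ℝ) : groundState c 0 = 1 := by
  simp [groundState, besselSeries_zero_zero]

theorem exists_le_integral_groundState_cutoff {s : ℝ} (c : ℝ) (hs : 0 < s) :
    ∃ κ, 0 < κ ∧ ∀ ε, 0 < ε → 4 * ε ≤ s →
      HasCompactSupport (radialCutoff s c ε) →
      κ ≤ ∫ x, (groundState c x * radialCutoff s c ε x) ^ 2 := by
  have hφ := (contDiff_groundState c).continuous
  have h1 : ∀ᶠ x in nhds (0 : E2), 1 / 2 < groundState c x :=
    (hφ.continuousAt (x := 0)).eventually_const_lt (by rw [groundState_zero]; norm_num)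
  have h2 : ∀ᶠ x in nhds (0 : E2), c * ‖x‖ ^ 2 < s / 2 := by
    have : Continuous fun x : E2 => c * ‖x‖ ^ 2 := by fun_prop
    exact (this.continuousAt (x := 0)).eventually_lt_const (by simpa using hs)
  obtain ⟨r, hr, hball⟩ := Metric.eventually_nhds_iff_ball.1 (h1.and h2)
  refine ⟨volume.real (Metric.ball (0 : E2) r) * (1 / 4), ?_, fun ε hε hεs hsupp => ?_⟩
  · exact mul_pos (ENNReal.toReal_pos (Metric.measure_ball_pos _ _ hr).ne'
      measure_ball_lt_top.ne) (by norm_num)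
  have hint : Integrable fun x => (groundState c x * radialCutoff s c ε x) ^ 2 := by
    have h3 : Continuous fun x => (groundState c x * radialCutoff s c ε x) ^ 2 :=
      (hφ.mul contDiff_radialCutoff.continuous).pow 2
    refine h3.integrable_of_hasCompactSupport (hsupp.mono fun x hx h0 => hx ?_)
    simp only [h0, mul_zero, ne_eq, OfNat.ofNat_ne_zero, not_false_eq_true, zero_pow]
  calc volume.real (Metric.ball (0 : E2) r) * (1 / 4) = ∫ x in Metric.ball (0 : E2) r, 1 / 4 := by
        rw [setIntegral_const, smul_eq_mul]
    _ ≤ ∫ x in Metric.ball (0 : E2) r, (groundState c x * radialCutoff s c ε x) ^ 2 := by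
        refine setIntegral_mono_on (integrableOn_const measure_ball_lt_top.ne) hint.integrableOn
          Metric.isOpen_ball.measurableSet fun x hx => ?_
        obtain ⟨h3, h4⟩ := hball x hx
        have : radialCutoff s c ε x = 1 := by
          refine smoothTransition.one_of_one_le ?_
          rw [le_sub_iff_add_le, le_div_iff₀ hε]
          linarith
        rw [this, mul_one]
        nlinarith
    _ ≤ _ := setIntegral_le_integral hint (.of_forall fun x => by positivity)

theorem besselSeries_zero_pos {lam t : ℝ} (hlam : lam < lambda1) (ht0 : 0 ≤ t)
    (ht : t ≤ lam / 4) : 0 < besselSeries 0 t := by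
  by_contra hneg
  obtain ⟨s, hst, hs⟩ := intermediate_value_Icc' ht0
    (contDiff_besselSeries 0).continuous.continuousOn
    (show (0 : ℝ) ∈ Icc _ _ from ⟨not_lt.1 hneg, by rw [besselSeries_zero_zero]; exact zero_le_one⟩)
  have hs0 : 0 < s := hst.1.lt_of_ne fun h => by
    rw [← h, besselSeries_zero_zero] at hs
    exact one_ne_zero hs
  set c := lam / 4 with hcdef
  have hsc : s ≤ c := hst.2.trans ht
  have hc : 0 < c := hs0.trans_le hsc
  obtain ⟨A, hA⟩ := exists_integral_groundState_cutoff_le hs0 hsc hs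
  obtain ⟨κ, hκ, hκ'⟩ := exists_le_integral_groundState_cutoff c hs0
  have key : ∀ ε, 0 < ε → 4 * ε ≤ s → (lambda1 - lam) * κ ≤ A * ε := by
    intro ε hε hεs
    have hsupp := hasCompactSupport_radialCutoff (s := s) hc hε
    have hu := isTestFun_groundState_mul_radialCutoff hc hsc hε
    have h1 := lambda1_mul_integral_sq_le hu
    rw [setIntegral_sq_of_isTestFun hu, setIntegral_norm_fderiv_sq_of_isTestFun hu,
      integral_norm_fderiv_groundState_mul_sq c (contDiff_radialCutoff.of_le (by simp)) hsupp] at h1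
    have h2 := hA ε hε (by linarith)
    have h3 := mul_le_mul_of_nonneg_left (hκ' ε hε hεs hsupp) (sub_pos.2 hlam).le
    have h4 : 4 * c = lam := by rw [hcdef]; ring
    rw [h4] at h1
    linarith
  have hpos : 0 < (lambda1 - lam) * κ := mul_pos (sub_pos.2 hlam) hκ
  have hA0 : 0 < A := by
    have := key (s / 4) (by linarith) (by linarith)
    exact pos_of_mul_pos_left (hpos.trans_le this) (by linarith)
  have := key (min (s / 4) ((lambda1 - lam) * κ / (2 * A))) (by positivity)
    (by linarith [min_le_left (s / 4) ((lambda1 - lam) * κ / (2 * A))])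
  have h5 : A * min (s / 4) ((lambda1 - lam) * κ / (2 * A)) ≤
      A * ((lambda1 - lam) * κ / (2 * A)) := by gcongr; exact min_le_right _ _
  have h6 : A * ((lambda1 - lam) * κ / (2 * A)) = (lambda1 - lam) * κ / 2 := by field_simp
  linarith

theorem groundState_pos {lam : ℝ} (hlam0 : 0 ≤ lam) (hlam : lam < lambda1) {x : E2}
    (hx : x ∈ Metric.closedBall (0 : E2) 1) : 0 < groundState (lam / 4) x := by
  rw [mem_closedBall_zero_iff] at hx
  refine besselSeries_zero_pos hlam (by positivity) ?_
  exact mul_le_of_le_one_right (by positivity) (pow_le_one₀ (norm_nonneg x) hx)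

theorem exists_groundState_le_mul {lam : ℝ} (hlam0 : 0 ≤ lam) (hlam : lam < lambda1) :
    ∃ K, 0 ≤ K ∧ ∀ x ∈ unitDisk, ∀ y ∈ unitDisk,
      groundState (lam / 4) x ≤ groundState (lam / 4) y * (1 + K * ‖x - y‖) := by
  set φ := groundState (lam / 4) with hφdef
  have hφ : ContDiff ℝ 1 φ := (contDiff_groundState _).of_le (by simp)
  have hcpt := isCompact_closedBall (0 : E2) 1
  obtain ⟨z, hz, hzmin⟩ := hcpt.exists_isMinOn ⟨0, by simp⟩ hφ.continuous.continuousOn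
  obtain ⟨L, hL⟩ := hcpt.exists_bound_of_continuousOn
    (hφ.continuous_fderiv one_ne_zero).continuousOn
  have hm : 0 < φ z := groundState_pos hlam0 hlam hz
  have hL0 : 0 ≤ L := (norm_nonneg _).trans (hL 0 (by simp))
  refine ⟨L / φ z, by positivity, fun x hx y hy => ?_⟩
  have hx' := Metric.ball_subset_closedBall hx
  have hy' := Metric.ball_subset_closedBall hy
  have h1 := (convex_closedBall (0 : E2) 1).norm_image_sub_le_of_norm_fderiv_le
    (fun w _ => hφ.differentiable one_ne_zero w) hL hy' hx'
  have h2 : φ z ≤ φ y := hzmin hy'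
  have h3 : L * ‖x - y‖ ≤ φ y * (L / φ z * ‖x - y‖) := by
    calc L * ‖x - y‖ = φ z * (L / φ z * ‖x - y‖) := by field_simp
      _ ≤ _ := by gcongr
  linarith [(Real.le_norm_self _).trans h1]

theorem ENNReal.mul_inv_le_mul_inv_add {a b k r : ℝ≥0∞} (h : a ≤ b * (1 + k * r)) :
    a * r⁻¹ ≤ b * (r⁻¹ + k) :=
  calc a * r⁻¹ ≤ b * (1 + k * r) * r⁻¹ := by gcongr
    _ = b * (r⁻¹ + k * (r * r⁻¹)) := by ring
    _ ≤ b * (r⁻¹ + k * 1) := by gcongr; exact ENNReal.mul_inv_le_one r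
    _ = b * (r⁻¹ + k) := by rw [mul_one]

theorem isTestFun_div {Ω : Set E2} {u φ : E2 → ℝ} (hu : IsTestFun Ω u)
    (hφ : ContDiff ℝ (⊤ : ℕ∞) φ) (hpos : ∀ x ∈ Ω, φ x ≠ 0) :
    IsTestFun Ω fun x => u x / φ x := by
  have hsub : tsupport (fun x => u x / φ x) ⊆ tsupport u :=
    closure_mono fun x hx h0 => hx (by simp [show u x = 0 from h0])
  refine ⟨contDiff_iff_contDiffAt.2 fun x => ?_,
    hu.2.1.of_isClosed_subset (isClosed_tsupport _) hsub, hsub.trans hu.2.2⟩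
  by_cases hx : x ∈ tsupport u
  · exact hu.1.contDiffAt.div hφ.contDiffAt (hpos x (hu.2.2 hx))
  · have : (fun x => u x / φ x) =ᶠ[nhds x] fun _ => 0 := by
      filter_upwards [(notMem_tsupport_iff_eventuallyEq.1 hx)] with y hy
      rw [hy]; simp
    exact contDiffAt_const.congr_of_eventuallyEq this

/-- Adimurthi–Druet: for `0 ≤ λ < λ₁`, the Trudinger-Moser supremum under
the constraint `∫|∇u|² - λ∫u² ≤ 1` is finite. -/
theorem trudinger_moser_adimurthi_druet (lam : ℝ) (hlam0 : 0 ≤ lam) (hlam : lam < lambda1) :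
    ∃ C : ℝ, ∀ u : E2 → ℝ, IsTestFun unitDisk u →
      (∫ x in unitDisk, ‖fderiv ℝ u x‖ ^ 2) - lam * (∫ x in unitDisk, u x ^ 2) ≤ 1 →
      (∫ x in unitDisk, Real.exp (4 * π * u x ^ 2)) ≤ C := by
  obtain ⟨K, hK0, hK⟩ := exists_groundState_le_mul hlam0 hlam
  refine ⟨(expBound K).toReal, fun u hu hle => ?_⟩
  set φ := groundState (lam / 4) with hφdef
  have hφ : ContDiff ℝ (⊤ : ℕ∞) φ := contDiff_groundState _
  have hφpos : ∀ x ∈ unitDisk, 0 < φ x := fun x hx =>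
    groundState_pos hlam0 hlam (Metric.ball_subset_closedBall hx)
  set v : E2 → ℝ := fun x => u x / φ x with hvdef
  have hv : IsTestFun unitDisk v := isTestFun_div hu hφ fun x hx => (hφpos x hx).ne'
  have hv1 : ContDiff ℝ 1 v := hv.1.of_le (by simp)
  have hvc : HasCompactSupport v := hv.2.1
  have huv : u = fun x => φ x * v x := by
    funext x
    by_cases hx : x ∈ unitDisk
    · exact (mul_div_cancel₀ _ (hφpos x hx).ne').symm
    · simp [hvdef, image_eq_zero_of_notMem_tsupport fun h => hx (hu.2.2 h)]
  have hBm : MeasurableSet unitDisk := Metric.isOpen_ball.measurableSet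
  have hdv : Continuous (fderiv ℝ v) := hv1.continuous_fderiv one_ne_zero
  have henergy : ∫ x, φ x ^ 2 * ‖fderiv ℝ v x‖ ^ 2 ≤ 1 := by
    have h1 := integral_norm_fderiv_groundState_mul_sq (lam / 4) hv1 hvc
    rw [← hφdef, ← huv, show 4 * (lam / 4) = lam by ring] at h1
    have h2 : ∫ x, (φ x * v x) ^ 2 = ∫ x, u x ^ 2 := by rw [huv]
    rw [setIntegral_sq_of_isTestFun hu, setIntegral_norm_fderiv_sq_of_isTestFun hu] at hle
    rw [h2] at h1
    linarith
  obtain ⟨M, hM⟩ := hu.1.continuous.bounded_above_of_compact_support hu.2.1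
  set f : E2 → ℝ≥0∞ := fun y => ‖φ y‖ₑ * ‖fderiv ℝ v y‖ₑ with hfdef
  have hf : Measurable f :=
    hφ.continuous.measurable.enorm.mul hdv.measurable.enorm
  have hf1 : ∫⁻ y in unitDisk, f y ^ 2 ≤ 1 := by
    have hint : Integrable fun x => φ x ^ 2 * ‖fderiv ℝ v x‖ ^ 2 := by
      have hcont : Continuous fun x => φ x ^ 2 * ‖fderiv ℝ v x‖ ^ 2 :=
        (hφ.continuous.pow 2).mul (hdv.norm.pow 2)
      refine hcont.integrable_of_hasCompactSupport ((hvc.fderiv (𝕜 := ℝ)).mono fun x hx h0 => hx ?_)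
      simp only [h0, norm_zero, ne_eq, OfNat.ofNat_ne_zero, not_false_eq_true, zero_pow, mul_zero]
    have hfy : ∀ y, f y ^ 2 = ENNReal.ofReal (φ y ^ 2 * ‖fderiv ℝ v y‖ ^ 2) := fun y => by
      rw [hfdef, ← sq_abs (φ y), ← mul_pow, ENNReal.ofReal_pow (by positivity),
        ENNReal.ofReal_mul (by positivity), ← Real.norm_eq_abs, ofReal_norm,
        ofReal_norm]
    calc ∫⁻ y in unitDisk, f y ^ 2 ≤ ∫⁻ y, f y ^ 2 := setLIntegral_le_lintegral _ _
      _ = ENNReal.ofReal (∫ x, φ x ^ 2 * ‖fderiv ℝ v x‖ ^ 2) := by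
          rw [ofReal_integral_eq_lintegral_ofReal hint (.of_forall fun x => by positivity)]
          simp only [hfy]
      _ ≤ 1 := by rw [← ENNReal.ofReal_one]; exact ENNReal.ofReal_le_ofReal henergy
  have hriesz : ∀ x ∈ unitDisk, ENNReal.ofReal (2 * π) * ‖u x‖ₑ ≤
      ∫⁻ y in unitDisk, f y * rieszKernel K x y := by
    intro x hx
    have hsupp : ∫⁻ y, ‖fderiv ℝ v y‖ₑ * ‖x - y‖ₑ⁻¹ =
        ∫⁻ y in unitDisk, ‖fderiv ℝ v y‖ₑ * ‖x - y‖ₑ⁻¹ := by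
      rw [← lintegral_indicator hBm, indicator_eq_self.2]
      intro y hy
      by_contra hyB
      refine hy ?_
      dsimp only
      rw [fderiv_eq_zero_of_isTestFun hv hyB, ← ofReal_norm, norm_zero, ENNReal.ofReal_zero,
        zero_mul]
    calc ENNReal.ofReal (2 * π) * ‖u x‖ₑ = ‖φ x‖ₑ * (ENNReal.ofReal (2 * π) * ‖v x‖ₑ) := by
          rw [congrFun huv x, enorm_mul]; ring
      _ ≤ ‖φ x‖ₑ * ∫⁻ y, ‖fderiv ℝ v y‖ₑ * ‖x - y‖ₑ⁻¹ := by
          gcongr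
          exact enorm_le_riesz hv1 hvc x
      _ = ∫⁻ y in unitDisk, ‖φ x‖ₑ * (‖fderiv ℝ v y‖ₑ * ‖x - y‖ₑ⁻¹) := by
          rw [hsupp, lintegral_const_mul' _ _ enorm_ne_top]
      _ ≤ ∫⁻ y in unitDisk, f y * rieszKernel K x y := by
          refine setLIntegral_mono' hBm fun y hy => ?_
          have h1 : ‖φ x‖ₑ ≤ ‖φ y‖ₑ * (1 + ENNReal.ofReal K * ‖x - y‖ₑ) := by
            rw [Real.enorm_of_nonneg (hφpos x hx).le, Real.enorm_of_nonneg (hφpos y hy).le,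
              ← ofReal_norm (x - y), ← ENNReal.ofReal_mul hK0, ← ENNReal.ofReal_one,
              ← ENNReal.ofReal_add zero_le_one (by positivity),
              ← ENNReal.ofReal_mul (hφpos y hy).le]
            exact ENNReal.ofReal_le_ofReal (hK x hx y hy)
          calc ‖φ x‖ₑ * (‖fderiv ℝ v y‖ₑ * ‖x - y‖ₑ⁻¹)
              = ‖fderiv ℝ v y‖ₑ * (‖φ x‖ₑ * ‖x - y‖ₑ⁻¹) := by ring
            _ ≤ ‖fderiv ℝ v y‖ₑ * (‖φ y‖ₑ * (‖x - y‖ₑ⁻¹ + ENNReal.ofReal K)) := by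
                gcongr ‖fderiv ℝ v y‖ₑ * ?_
                exact ENNReal.mul_inv_le_mul_inv_add h1
            _ = f y * rieszKernel K x y := by rw [hfdef, rieszKernel]; ring
  have hmain := lintegral_exp_le_expBound hK0 hu.1.continuous.measurable hM hf hf1 hriesz
  have hexp : Continuous fun x => Real.exp (4 * π * u x ^ 2) :=
    Real.continuous_exp.comp (continuous_const.mul (hu.1.continuous.pow 2))
  rw [integral_eq_lintegral_of_nonneg_ae (.of_forall fun x => (Real.exp_pos _).le)
    hexp.aestronglyMeasurable]
  exact ENNReal.toReal_mono (expBound_ne_top K) hmain
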